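/- arXiv:2006.06732 — 4 statements merged into one kernel-verified Lean document; each statement's English description precedes it below -/
import Mathlib

section
/- Suppose G : H → ℝ is μ-strongly convex and locally Lipschitz smooth in the strong sense, and let η > 0 and x₀ ∈ H. Then there exists a unique twice continuously differentiable function X : [0,∞) → H satisfying Ẍ(t) + 2η Ẋ(t) + 𝓛⁻¹G'(X(t)) = 0 for all t > 0, with X(0) = x₀ and Ẋ(0) = 0; moreover, for all t ≥ 0, the solution obeys the energy identity (1/2)‖Ẋ(t)‖_𝓛² + G(X(t)) − G* = G(x₀) − G* − 2η ∫₀ᵗ ‖Ẋ(τ)‖_𝓛² dτ, where G* is the minimum value of G. -/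
open TopologicalSpace Set

section aux
open Metric NNReal

lemma aux_cutoff {E : Type*} [NormedAddCommGroup E] [NormedSpace ℝ E] (f : E → E)
    (hf : ∀ R : ℝ, ∃ K : ℝ≥0, LipschitzOnWith K f (closedBall 0 R)) (R : ℝ) :
    ∃ (χ : E → ℝ) (K M : ℝ≥0), (∀ z, 0 ≤ χ z) ∧ (∀ z, ‖z‖ ≤ R → χ z = 1) ∧
      LipschitzWith K (fun z => χ z • f z) ∧ ∀ z, ‖χ z • f z‖ ≤ M := by
  obtain ⟨K, hK⟩ := hf (R + 1)
  have hfb : ∃ M : ℝ≥0, ∀ z, ‖z‖ ≤ R + 1 → ‖f z‖ ≤ M := by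
    by_cases hR : 0 ≤ R + 1
    · refine ⟨K * (R + 1).toNNReal + ‖f 0‖₊, fun z hz => ?_⟩
      have h := hK.dist_le_mul z (by simpa using hz) 0 (by simpa using hR)
      have h2 : ‖f z‖ ≤ ‖f z - f 0‖ + ‖f 0‖ := by
        simpa using norm_add_le (f z - f 0) (f 0)
      rw [dist_eq_norm, dist_zero_right] at h
      push_cast
      rw [Real.coe_toNNReal _ hR]
      have : (K : ℝ) * ‖z‖ ≤ K * (R + 1) := by gcongr
      linarith
    · exact ⟨0, fun z hz => absurd ((norm_nonneg z).trans hz) hR⟩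
  obtain ⟨M, hM⟩ := hfb
  set χ : E → ℝ := fun z => max 0 (min 1 (R + 1 - ‖z‖)) with hχ
  have h0 : ∀ z, 0 ≤ χ z := fun z => le_max_left _ _
  have h1 : ∀ z, χ z ≤ 1 := fun z => max_le zero_le_one (min_le_left _ _)
  have hout : ∀ z, R + 1 < ‖z‖ → χ z = 0 := fun z hz =>
    max_eq_left ((min_le_right _ _).trans (by linarith))
  have hlip : ∀ x y, |χ x - χ y| ≤ ‖x - y‖ := by
    intro x y
    have h2 := abs_norm_sub_norm_le x y
    have h3 : |χ x - χ y| ≤ |min 1 (R + 1 - ‖x‖) - min 1 (R + 1 - ‖y‖)| := by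
      simpa [hχ] using abs_max_sub_max_le_max 0 (min 1 (R + 1 - ‖x‖)) 0 (min 1 (R + 1 - ‖y‖))
    have h4 : |min 1 (R + 1 - ‖x‖) - min 1 (R + 1 - ‖y‖)| ≤ |(R + 1 - ‖x‖) - (R + 1 - ‖y‖)| := by
      simpa using abs_min_sub_min_le_max 1 (R + 1 - ‖x‖) 1 (R + 1 - ‖y‖)
    have h5 : |(R + 1 - ‖x‖) - (R + 1 - ‖y‖)| = |‖x‖ - ‖y‖| := by
      rw [← abs_neg]; congr 1; ring
    linarith
  have key : ∀ x y, ‖x‖ ≤ R + 1 → ‖χ x • f x - χ y • f y‖ ≤ (K + M) * ‖x - y‖ := by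
    intro x y hx
    have e : χ x • f x - χ y • f y = (χ x - χ y) • f x + χ y • (f x - f y) := by
      rw [sub_smul, smul_sub]; abel
    have a1 : ‖(χ x - χ y) • f x‖ ≤ M * ‖x - y‖ := by
      rw [norm_smul, Real.norm_eq_abs, mul_comm]
      exact mul_le_mul (hM x hx) (hlip x y) (abs_nonneg _) M.2
    have a2 : ‖χ y • (f x - f y)‖ ≤ K * ‖x - y‖ := by
      by_cases hy : ‖y‖ ≤ R + 1
      · have h := hK.dist_le_mul x (by simpa using hx) y (by simpa using hy)
        rw [dist_eq_norm, dist_eq_norm] at h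
        rw [norm_smul, Real.norm_eq_abs, abs_of_nonneg (h0 y)]
        have := mul_le_of_le_one_left (norm_nonneg (f x - f y)) (h1 y)
        linarith
      · rw [hout y (not_le.1 hy)]; simp; positivity
    rw [e]
    have := norm_add_le ((χ x - χ y) • f x) (χ y • (f x - f y))
    linarith
  refine ⟨χ, K + M, M, h0, ?_, ?_, ?_⟩
  · intro z hz
    have : min 1 (R + 1 - ‖z‖) = 1 := min_eq_left (by linarith)
    simp [hχ, this]
  · refine LipschitzWith.of_dist_le_mul fun x y => ?_
    rw [dist_eq_norm, dist_eq_norm]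
    push_cast
    by_cases hx : ‖x‖ ≤ R + 1
    · exact key x y hx
    by_cases hy : ‖y‖ ≤ R + 1
    · rw [norm_sub_rev, norm_sub_rev x y]; exact key y x hy
    · rw [hout x (not_le.1 hx), hout y (not_le.1 hy)]; simp; positivity
  · intro z
    by_cases hz : ‖z‖ ≤ R + 1
    · rw [norm_smul, Real.norm_eq_abs, abs_of_nonneg (h0 z)]
      exact (mul_le_of_le_one_left (norm_nonneg _) (h1 z)).trans (hM z hz)
    · rw [hout z (not_le.1 hz)]; simp

lemma aux_global {E : Type*} [NormedAddCommGroup E] [NormedSpace ℝ E] [CompleteSpace E]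
    (F : E → E) (K M : ℝ≥0) (hF : LipschitzWith K F) (hM : ∀ z, ‖F z‖ ≤ M) (z₀ : E) :
    ∃ Z : ℝ → E, Z 0 = z₀ ∧ ∀ t ∈ Ici (0:ℝ), HasDerivWithinAt Z (F (Z t)) (Ici 0) t := by
  have hex : ∀ T : ℝ, 0 ≤ T → ∃ α : ℝ → E, α 0 = z₀ ∧
      ∀ t ∈ Icc 0 T, HasDerivWithinAt α (F (α t)) (Icc 0 T) t := by
    intro T hT
    have hP : IsPicardLindelof (fun _ => F) (tmin := 0) (tmax := T) ⟨0, le_rfl, hT⟩ z₀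
        (M * T.toNNReal) 0 M K := by
      refine ⟨fun t _ => hF.lipschitzOnWith, fun x _ => continuousOn_const,
        fun t _ x _ => hM x, ?_⟩
      simp [Real.coe_toNNReal _ hT, max_eq_left hT]
    exact hP.exists_eq_forall_mem_Icc_hasDerivWithinAt₀
  choose! α h0 hd using hex
  have hr : ∀ T, 0 ≤ T → ∀ t ∈ Ico 0 T, HasDerivWithinAt (α T) (F (α T t)) (Ici t) t := by
    intro T hT t ht
    refine (hd T hT t ⟨ht.1, ht.2.le⟩).mono_of_mem_nhdsWithin ?_
    exact Filter.mem_of_superset (Icc_mem_nhdsGE ht.2) (Icc_subset_Icc_left ht.1)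
  have huniq : ∀ S T, 0 ≤ S → S ≤ T → EqOn (α S) (α T) (Icc 0 S) := by
    intro S T hS hST
    refine ODE_solution_unique (v := fun _ => F) (K := K) (fun _ => hF)
      (fun t ht => (hd S hS t ht).continuousWithinAt) (hr S hS)
      (fun t ht => ((hd T (hS.trans hST) t ⟨ht.1, ht.2.trans hST⟩).continuousWithinAt).mono
        (Icc_subset_Icc_right hST))
      (fun t ht => hr T (hS.trans hST) t ⟨ht.1, ht.2.trans_le hST⟩) ?_
    rw [h0 S hS, h0 T (hS.trans hST)]
  have heq : ∀ T, 0 ≤ T → ∀ t ∈ Icc 0 T, α t t = α T t := fun T hT t ht =>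
    huniq t T ht.1 ht.2 ⟨ht.1, le_rfl⟩
  refine ⟨fun t => α t t, h0 0 le_rfl, fun t ht => ?_⟩
  have ht : 0 ≤ t := ht
  have hT : 0 ≤ t + 1 := by linarith
  have hm : t ∈ Icc 0 (t + 1) := ⟨ht, by linarith⟩
  have hd1 : HasDerivWithinAt (fun t => α t t) (F (α t t)) (Icc 0 (t + 1)) t := by
    rw [heq _ hT t hm]
    exact (hd _ hT t hm).congr (fun s hs => heq _ hT s hs) (heq _ hT t hm)
  refine hd1.mono_of_mem_nhdsWithin ?_
  have : Iic (t + 1) ∈ nhds t := Iic_mem_nhds (by linarith)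
  filter_upwards [self_mem_nhdsWithin, mem_nhdsWithin_of_mem_nhds this] with s h1 h2
  exact ⟨h1, h2⟩

lemma aux_exist {E : Type*} [NormedAddCommGroup E] [NormedSpace ℝ E] [CompleteSpace E]
    (f : E → E) (hf : ∀ R : ℝ, ∃ K : ℝ≥0, LipschitzOnWith K f (closedBall 0 R))
    (V : E → ℝ) (V' : E → E →L[ℝ] ℝ) (hV : ∀ z, HasFDerivAt V (V' z) z)
    (hdec : ∀ z, V' z (f z) ≤ 0) (z₀ : E) (R : ℝ) (hS : ∀ z, V z ≤ V z₀ → ‖z‖ ≤ R) :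
    ∃ Z : ℝ → E, Z 0 = z₀ ∧ ∀ t ∈ Ici (0:ℝ), HasDerivWithinAt Z (f (Z t)) (Ici 0) t := by
  obtain ⟨χ, K, M, hχ0, hχ1, hl, hb⟩ := aux_cutoff f hf R
  obtain ⟨Z, h0, hZ⟩ := aux_global _ K M hl hb z₀
  refine ⟨Z, h0, fun t ht => ?_⟩
  have hVZ : ∀ t ∈ Ici (0:ℝ), HasDerivWithinAt (fun s => V (Z s)) (V' (Z t) (χ (Z t) • f (Z t)))
      (Ici 0) t := fun t ht => (hV (Z t)).comp_hasDerivWithinAt t (hZ t ht)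
  have hanti : AntitoneOn (fun s => V (Z s)) (Ici 0) := by
    refine antitoneOn_of_hasDerivWithinAt_nonpos (convex_Ici 0)
      (f' := fun t => V' (Z t) (χ (Z t) • f (Z t)))
      (fun t ht => (hVZ t ht).continuousWithinAt)
      (fun t ht => (hVZ t (interior_subset ht)).mono interior_subset) ?_
    intro t _
    rw [map_smul, smul_eq_mul]
    exact mul_nonpos_of_nonneg_of_nonpos (hχ0 _) (hdec _)
  have h1 : V (Z t) ≤ V z₀ := by
    have := hanti (mem_Ici.2 le_rfl) ht ht
    simpa [h0] using this
  have h2 := hZ t ht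
  rwa [hχ1 _ (hS _ h1), one_smul] at h2

lemma aux_unique {E : Type*} [NormedAddCommGroup E] [NormedSpace ℝ E]
    (f : E → E) (hf : ∀ R : ℝ, ∃ K : ℝ≥0, LipschitzOnWith K f (closedBall 0 R))
    (Y Z : ℝ → E) (h0 : Y 0 = Z 0)
    (hY : ∀ t ∈ Ici (0:ℝ), HasDerivWithinAt Y (f (Y t)) (Ici 0) t)
    (hZ : ∀ t ∈ Ici (0:ℝ), HasDerivWithinAt Z (f (Z t)) (Ici 0) t) :
    ∀ t ∈ Ici (0:ℝ), Y t = Z t := by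
  intro t ht
  have cY : ContinuousOn Y (Icc 0 t) := fun s hs =>
    (hY s hs.1).continuousWithinAt.mono Icc_subset_Ici_self
  have cZ : ContinuousOn Z (Icc 0 t) := fun s hs =>
    (hZ s hs.1).continuousWithinAt.mono Icc_subset_Ici_self
  obtain ⟨R₁, hR₁⟩ := isCompact_Icc.exists_bound_of_continuousOn cY
  obtain ⟨R₂, hR₂⟩ := isCompact_Icc.exists_bound_of_continuousOn cZ
  obtain ⟨K, hK⟩ := hf (max R₁ R₂)
  refine ODE_solution_unique_of_mem_Icc_right (v := fun _ => f)
    (s := fun _ => closedBall 0 (max R₁ R₂)) (K := K) (fun _ _ => hK)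
    cY (fun s hs => (hY s hs.1).mono (Ici_subset_Ici.2 hs.1)) ?_
    cZ (fun s hs => (hZ s hs.1).mono (Ici_subset_Ici.2 hs.1)) ?_ h0 ⟨ht, le_rfl⟩
  · intro s hs
    simpa using Or.inl (hR₁ s ⟨hs.1, hs.2.le⟩)
  · intro s hs
    simpa using Or.inr (hR₂ s ⟨hs.1, hs.2.le⟩)

end aux

/-- existence, uniqueness, and the energy identity for the IVP
`Ẍ + 2η Ẋ + 𝓛⁻¹G'(X) = 0`, `X(0) = x₀`, `Ẋ(0) = 0`, when `G` is `μ`-strongly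
convex and locally Lipschitz smooth in the strong sense. The solution is twice
continuously differentiable on `[0,∞)` and obeys
`(1/2)‖Ẋ(t)‖_𝓛² + G(X(t)) − G* = G(x₀) − G* − 2η ∫₀ᵗ ‖Ẋ(τ)‖_𝓛² dτ`. -/
theorem IVP_existence_uniqueness_energy_identity
    {H : Type*} [NormedAddCommGroup H] [InnerProductSpace ℝ H]
    [CompleteSpace H] [SeparableSpace H]
    (L : H →ₗ[ℝ] (H →L[ℝ] ℝ))
    (C₁ C₂ : ℝ) (hC₁ : 0 < C₁) (hC₂ : 0 < C₂)
    (hsymm : ∀ x y : H, L x y = L y x)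
    (hbdd : ∀ x y : H, L x y ≤ C₂ * ‖x‖ * ‖y‖)
    (hcoer : ∀ x : H, C₁ * ‖x‖ ^ 2 ≤ L x x)
    (Linv : (H →L[ℝ] ℝ) → H)
    (hLinv : ∀ f : H →L[ℝ] ℝ, L (Linv f) = f)
    (hLinv' : ∀ x : H, Linv (L x) = x)
    (G : H → ℝ) (G' : H → H →L[ℝ] ℝ)
    (hdiff : ∀ x : H, HasFDerivAt G (G' x) x)
    (μ : ℝ) (hμ : 0 < μ)
    -- μ-strong convexity
    (hsc : ∀ x y : H, (G' x - G' y) (x - y) ≥ μ * L (x - y) (x - y))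
    -- local Lipschitz smoothness in the strong sense:
    -- ‖G'(x) − G'(y)‖_{𝓛⁻¹} ≤ L_B ‖x − y‖_𝓛 on every bounded convex set B
    (hlip : ∀ B : Set H, Convex ℝ B → Bornology.IsBounded B →
      ∃ LB > (0:ℝ), ∀ x ∈ B, ∀ y ∈ B,
        Real.sqrt ((G' x - G' y) (Linv (G' x - G' y)))
          ≤ LB * Real.sqrt (L (x - y) (x - y)))
    -- minimizer and minimum value G*
    (xstar : H) (hmin : ∀ y : H, G xstar ≤ G y)
    (η : ℝ) (hη : 0 < η) (x₀ : H) :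
    ∃ X X' X'' : ℝ → H,
      -- X is a twice continuously differentiable solution on [0,∞)
      (∀ t ∈ Ici (0:ℝ), HasDerivWithinAt X (X' t) (Ici 0) t) ∧
      (∀ t ∈ Ici (0:ℝ), HasDerivWithinAt X' (X'' t) (Ici 0) t) ∧
      ContinuousOn X'' (Ici 0) ∧
      X 0 = x₀ ∧ X' 0 = 0 ∧
      (∀ t > (0:ℝ), X'' t + (2 * η) • X' t + Linv (G' (X t)) = 0) ∧
      -- the energy identity
      (∀ t ∈ Ici (0:ℝ),
        (1 / 2) * L (X' t) (X' t) + G (X t) - G xstar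
          = G x₀ - G xstar
              - 2 * η * ∫ τ in (0:ℝ)..t, L (X' τ) (X' τ)) ∧
      -- uniqueness among twice continuously differentiable solutions
      (∀ Y Y' Y'' : ℝ → H,
        (∀ t ∈ Ici (0:ℝ), HasDerivWithinAt Y (Y' t) (Ici 0) t) →
        (∀ t ∈ Ici (0:ℝ), HasDerivWithinAt Y' (Y'' t) (Ici 0) t) →
        ContinuousOn Y'' (Ici 0) →
        Y 0 = x₀ → Y' 0 = 0 →
        (∀ t > (0:ℝ), Y'' t + (2 * η) • Y' t + Linv (G' (Y t)) = 0) →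
        ∀ t ∈ Ici (0:ℝ), Y t = X t) := by
  have hLn : ∀ x, ‖L x‖ ≤ C₂ * ‖x‖ := by
    intro x
    refine ContinuousLinearMap.opNorm_le_bound _ (by positivity) fun y => ?_
    rw [Real.norm_eq_abs, abs_le]
    have h1 := hbdd x y
    have h2 := hbdd x (-y)
    rw [norm_neg, map_neg] at h2
    constructor <;> linarith
  obtain ⟨Lc, hLc⟩ : ∃ Lc : H →L[ℝ] H →L[ℝ] ℝ, ∀ x, Lc x = L x :=
    ⟨L.mkContinuous C₂ hLn, fun x => rfl⟩
  have hsub : ∀ a b, Linv a - Linv b = Linv (a - b) := by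
    intro a b
    rw [← hLinv' (Linv a - Linv b), map_sub, hLinv, hLinv]
  set g : H → H := fun x => Linv (G' x) with hg
  have hLg : ∀ x, L (g x) = G' x := fun x => hLinv _
  -- local Lipschitz continuity of the preconditioned gradient
  have hgl : ∀ R : ℝ, ∃ K : NNReal, LipschitzOnWith K g (Metric.closedBall 0 R) := by
    intro R
    obtain ⟨LB, hLB, h⟩ := hlip (Metric.closedBall 0 R) (convex_closedBall 0 R)
      Metric.isBounded_closedBall
    refine ⟨(LB * Real.sqrt C₂ / Real.sqrt C₁).toNNReal,
      LipschitzOnWith.of_dist_le_mul fun x hx y hy => ?_⟩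
    rw [Real.coe_toNNReal _ (by positivity), dist_eq_norm, dist_eq_norm]
    have h1 := h x hx y hy
    rw [← hsub] at h1
    change Real.sqrt ((G' x - G' y) (g x - g y)) ≤ _ at h1
    rw [← hLg x, ← hLg y, ← map_sub] at h1
    have h2 : Real.sqrt C₁ * ‖g x - g y‖ ≤ Real.sqrt (L (g x - g y) (g x - g y)) := by
      rw [← Real.sqrt_sq (norm_nonneg (g x - g y)), ← Real.sqrt_mul hC₁.le]
      exact Real.sqrt_le_sqrt (hcoer _)
    have h3 : Real.sqrt (L (x - y) (x - y)) ≤ Real.sqrt C₂ * ‖x - y‖ := by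
      rw [← Real.sqrt_sq (norm_nonneg (x - y)), ← Real.sqrt_mul hC₂.le]
      refine Real.sqrt_le_sqrt ((hbdd _ _).trans ?_)
      apply le_of_eq; ring
    have h4 : LB * Real.sqrt (L (x - y) (x - y)) ≤ LB * (Real.sqrt C₂ * ‖x - y‖) := by gcongr
    rw [div_mul_eq_mul_div, le_div_iff₀ (Real.sqrt_pos.2 hC₁)]
    linarith
  have hgc : Continuous g := by
    rw [continuous_iff_continuousAt]
    intro x
    obtain ⟨K, hK⟩ := hgl (‖x‖ + 1)
    refine hK.continuousOn.continuousAt ?_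
    refine Filter.mem_of_superset (Metric.ball_mem_nhds x one_pos) fun y hy => ?_
    rw [mem_closedBall_zero_iff]
    rw [mem_ball_iff_norm] at hy
    have := norm_add_le (y - x) x
    rw [sub_add_cancel] at this
    linarith
  -- the first-order system
  set f : H × H → H × H := fun z => (z.2, -((2 * η) • z.2) - g z.1) with hfdef
  have hfl : ∀ R : ℝ, ∃ K : NNReal, LipschitzOnWith K f (Metric.closedBall 0 R) := by
    intro R
    obtain ⟨K, hK⟩ := hgl R
    have hfst : LipschitzOnWith (K * 1) (fun z : H × H => g z.1) (Metric.closedBall 0 R) := by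
      refine hK.comp LipschitzWith.prod_fst.lipschitzOnWith fun z hz => ?_
      rw [mem_closedBall_zero_iff] at hz ⊢
      exact (norm_fst_le z).trans hz
    have hlin : LipschitzOnWith _ (fun z : H × H => -((2 * η) • z.2)) (Metric.closedBall 0 R) :=
      ((-((2 * η) • ContinuousLinearMap.snd ℝ H H)).lipschitz).lipschitzOnWith
    exact ⟨_, (LipschitzWith.prod_snd.lipschitzOnWith).prodMk (hlin.sub hfst)⟩
  -- the energy
  set V : H × H → ℝ := fun z => (1 / 2) * L z.2 z.2 + G z.1 with hVdef
  have hV : ∀ z : H × H, HasFDerivAt V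
      ((Lc z.2).comp (ContinuousLinearMap.snd ℝ H H)
        + (G' z.1).comp (ContinuousLinearMap.fst ℝ H H)) z := by
    intro z
    have h1 : HasFDerivAt (fun z : H × H => z.2) (ContinuousLinearMap.snd ℝ H H) z :=
      hasFDerivAt_snd
    have h2 : HasFDerivAt (fun z : H × H => Lc z.2) (Lc.comp (ContinuousLinearMap.snd ℝ H H)) z :=
      Lc.hasFDerivAt.comp z h1
    have h3 := (h2.clm_apply h1).const_mul (1 / 2 : ℝ)
    have h4 : HasFDerivAt (fun z : H × H => G z.1)
        ((G' z.1).comp (ContinuousLinearMap.fst ℝ H H)) z :=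
      (hdiff z.1).comp z hasFDerivAt_fst
    have h5 := h3.add h4
    have e : V = (fun z : H × H => (1 / 2 : ℝ) * Lc z.2 z.2) + fun z : H × H => G z.1 := by
      funext w; simp [hVdef, hLc]
    rw [e]
    refine h5.congr_fderiv ?_
    apply ContinuousLinearMap.ext
    intro w
    have := hsymm w.2 z.2
    simp [hLc, this]
    ring
  have hVf : ∀ z : H × H, ((Lc z.2).comp (ContinuousLinearMap.snd ℝ H H)
        + (G' z.1).comp (ContinuousLinearMap.fst ℝ H H)) (f z) = -(2 * η) * L z.2 z.2 := by
    intro z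
    have : L z.2 (g z.1) = G' z.1 z.2 := by rw [hsymm, hLg]
    simp [hfdef, hLc, this]
  have hpos : ∀ x, 0 ≤ L x x := fun x => le_trans (by positivity) (hcoer x)
  -- quadratic growth
  have hstar : G' xstar = 0 :=
    IsLocalMin.hasFDerivAt_eq_zero (Filter.Eventually.of_forall hmin) (hdiff xstar)
  have hgrow : ∀ x, G xstar + μ / 2 * L (x - xstar) (x - xstar) ≤ G x := by
    intro x
    set d := x - xstar with hd
    have hder : ∀ s : ℝ, HasDerivAt (fun s : ℝ => G (xstar + s • d) - μ / 2 * L d d * s ^ 2)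
        (G' (xstar + s • d) d - μ / 2 * L d d * (2 * s)) s := by
      intro s
      have h1 : HasDerivAt (fun s : ℝ => xstar + s • d) d s := by
        simpa using ((hasDerivAt_id s).smul_const d).const_add xstar
      have h2 := (hdiff (xstar + s • d)).comp_hasDerivAt s h1
      have h3 := (hasDerivAt_pow 2 s).const_mul (μ / 2 * L d d)
      refine (h2.sub h3).congr_deriv ?_
      simp
    have hmono := monotoneOn_of_hasDerivWithinAt_nonneg (convex_Icc (0:ℝ) 1)
      (fun s _ => (hder s).continuousAt.continuousWithinAt)
      (fun s _ => (hder s).hasDerivWithinAt) (by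
        intro s hs
        rw [interior_Icc] at hs
        have h := hsc (xstar + s • d) xstar
        rw [hstar, sub_zero, add_sub_cancel_left] at h
        simp only [map_smul, _root_.smul_apply, smul_eq_mul] at h
        have h' : s * (μ * s * L d d) ≤ s * G' (xstar + s • d) d := by
          refine le_trans (le_of_eq ?_) h
          ring
        have := le_of_mul_le_mul_left h' hs.1
        linarith)
    have h := hmono (left_mem_Icc.2 zero_le_one) (right_mem_Icc.2 zero_le_one) zero_le_one
    have e : xstar + d = x := by rw [hd]; abel
    simp only [zero_smul, one_smul, add_zero, e] at h
    linarith
  have hbound : ∃ R : ℝ, ∀ z : H × H, V z ≤ V (x₀, 0) → ‖z‖ ≤ R := by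
    set c := G x₀ - G xstar with hc
    have hV0 : V (x₀, 0) = G x₀ := by simp [hVdef]
    refine ⟨max (Real.sqrt (2 * c / (μ * C₁)) + ‖xstar‖) (Real.sqrt (2 * c / C₁)), fun z hz => ?_⟩
    rw [hV0] at hz
    simp only [hVdef] at hz
    have h1 := hgrow z.1
    have h2 := hcoer (z.1 - xstar)
    have h3 := hcoer z.2
    have h4 := hpos z.2
    have h5 := hmin z.1
    rw [Prod.norm_def]
    refine max_le_max ?_ ?_
    · have : ‖z.1 - xstar‖ ≤ Real.sqrt (2 * c / (μ * C₁)) := by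
        apply Real.le_sqrt_of_sq_le
        rw [le_div_iff₀ (by positivity)]
        have := mul_le_mul_of_nonneg_left h2 hμ.le
        linarith
      have h6 := norm_add_le (z.1 - xstar) xstar
      rw [sub_add_cancel] at h6
      linarith
    · apply Real.le_sqrt_of_sq_le
      rw [le_div_iff₀ hC₁]
      linarith
  obtain ⟨R, hR⟩ := hbound
  obtain ⟨Z, hZ0, hZ⟩ := aux_exist f hfl V _ hV (fun z => by
    rw [hVf]
    have := mul_nonneg hη.le (hpos z.2)
    linarith) (x₀, 0) R hR
  have hZ1 : ∀ t ∈ Ici (0:ℝ), HasDerivWithinAt (fun t => (Z t).1) (Z t).2 (Ici 0) t :=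
    fun t ht => ((ContinuousLinearMap.fst ℝ H H).hasFDerivAt (x := Z t)).comp_hasDerivWithinAt t (hZ t ht)
  have hZ2 : ∀ t ∈ Ici (0:ℝ), HasDerivWithinAt (fun t => (Z t).2)
      (-((2 * η) • (Z t).2) - g (Z t).1) (Ici 0) t :=
    fun t ht => ((ContinuousLinearMap.snd ℝ H H).hasFDerivAt (x := Z t)).comp_hasDerivWithinAt t (hZ t ht)
  have hZc1 : ContinuousOn (fun t => (Z t).1) (Ici 0) := fun t ht => (hZ1 t ht).continuousWithinAt
  have hZc2 : ContinuousOn (fun t => (Z t).2) (Ici 0) := fun t ht => (hZ2 t ht).continuousWithinAt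
  refine ⟨fun t => (Z t).1, fun t => (Z t).2, fun t => -((2 * η) • (Z t).2) - g (Z t).1,
    hZ1, hZ2, ?_, by simp [hZ0], by simp [hZ0], ?_, ?_, ?_⟩
  · exact ((hZc2.const_smul (2 * η)).neg).sub (hgc.comp_continuousOn hZc1)
  · intro t _
    simp only [hg]
    abel
  · intro t ht
    have ht : 0 ≤ t := ht
    have hVZ : ∀ s ∈ Ici (0:ℝ), HasDerivWithinAt (fun s => V (Z s))
        (-(2 * η) * L (Z s).2 (Z s).2) (Ici 0) s := by
      intro s hs
      have := (hV (Z s)).comp_hasDerivWithinAt s (hZ s hs)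
      rwa [hVf] at this
    have hcL : ContinuousOn (fun s => L (Z s).2 (Z s).2) (Ici 0) := by
      have : ContinuousOn (fun s => Lc (Z s).2 (Z s).2) (Ici 0) :=
        (Lc.continuous.comp_continuousOn hZc2).clm_apply hZc2
      simpa only [hLc] using this
    have hI := intervalIntegral.integral_eq_sub_of_hasDerivAt_of_le ht
      (f := fun s => V (Z s)) (f' := fun s => -(2 * η) * L (Z s).2 (Z s).2)
      (fun s hs => (hVZ s hs.1).continuousWithinAt.mono Icc_subset_Ici_self)
      (fun s hs => (hVZ s hs.1.le).hasDerivAt (Ici_mem_nhds hs.1))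
      (ContinuousOn.intervalIntegrable (by
        rw [uIcc_of_le ht]
        exact (continuousOn_const.mul hcL).mono Icc_subset_Ici_self))
    rw [intervalIntegral.integral_const_mul] at hI
    simp only [hVdef, hZ0, map_zero] at hI
    simp only
    linarith
  · intro Y Y' Y'' hY hY' hYc hY0 hY'0 hYe t ht
    have cY : ContinuousOn Y (Ici 0) := fun t ht => (hY t ht).continuousWithinAt
    have cY' : ContinuousOn Y' (Ici 0) := fun t ht => (hY' t ht).continuousWithinAt
    have hE : EqOn (fun t => Y'' t + (2 * η) • Y' t + g (Y t)) (fun _ => 0) (Ici 0) := by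
      refine EqOn.of_subset_closure (s := Ioi 0) (fun t ht => hYe t ht)
        ((hYc.add (cY'.const_smul (2 * η))).add (hgc.comp_continuousOn cY))
        continuousOn_const Ioi_subset_Ici_self ?_
      rw [closure_Ioi]
    have hW : ∀ t ∈ Ici (0:ℝ), HasDerivWithinAt (fun t => (Y t, Y' t)) (f (Y t, Y' t)) (Ici 0) t := by
      intro t ht
      have e : Y'' t = -((2 * η) • Y' t) - g (Y t) := by
        have h := hE ht
        simp only at h
        rw [add_assoc] at h
        rw [eq_neg_of_add_eq_zero_left h]
        abel
      have := (hY t ht).prodMk (hY' t ht)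
      rwa [e] at this
    have := aux_unique f hfl (fun t => (Y t, Y' t)) Z (by simp [hY0, hY'0, hZ0]) hW hZ t ht
    exact congrArg Prod.fst this
end

section
/- Let G : H → ℝ be μ-strongly convex and locally Lipschitz smooth, with minimizer x* and minimum G*, and run PAGD with friction η = √μ and step size s ∈ (0, min{1/L_B, ((r−1)/(r+1))²/μ}], where r > 1 and L_B is a Lipschitz smoothness constant of G on the invariant set 𝔅 = {x ∈ H : ‖x − x*‖_𝓛 ≤ R} with R = √((2/μ)(G(x₀) − G*)) + (1/η)√(2r(G(x₀) − G*)). Then the Lyapunov function decays exponentially along the iterates: for all k ≥ 0, E(x_{k+1}, v_{k+1} − x*) ≤ (1 − θ) E(x_k, v_k − x*), and consequently E(x_k, v_k − x*) ≤ (1 − θ)^k E₀. -/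
open TopologicalSpace

namespace PAGDAux

variable {H : Type*} [NormedAddCommGroup H] [InnerProductSpace ℝ H]

/-- One-dimensional integration of a monotonicity inequality. -/
lemma lower_bound (G : H → ℝ) (G' : H → H →L[ℝ] ℝ)
    (hdiff : ∀ x : H, HasFDerivAt G (G' x) x) (w d : H) (c q : ℝ)
    (h : ∀ t : ℝ, 0 < t → t < 1 → c * (t ^ 2 * q) ≤ (G' (w + t • d) - G' w) (t • d)) :
    G w + G' w d + c / 2 * q ≤ G (w + d) := by
  have hder : ∀ t : ℝ, HasDerivAt (fun t : ℝ => G (w + t • d) - t * G' w d - c / 2 * q * t ^ 2)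
      (G' (w + t • d) d - G' w d - c * q * t) t := by
    intro t
    have h1 : HasDerivAt (fun t : ℝ => w + t • d) d t := by
      simpa using ((hasDerivAt_id t).smul_const d).const_add w
    have h2 := (hdiff (w + t • d)).comp_hasDerivAt t h1
    have h3 : HasDerivAt (fun t : ℝ => t * G' w d) (G' w d) t := by
      simpa using (hasDerivAt_id t).mul_const (G' w d)
    have h4 : HasDerivAt (fun t : ℝ => c / 2 * q * t ^ 2) (c / 2 * q * (2 * t)) t := by
      simpa using (hasDerivAt_pow 2 t).const_mul (c / 2 * q)
    exact ((h2.sub h3).sub h4).congr_deriv (by ring)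
  have hmono : MonotoneOn (fun t : ℝ => G (w + t • d) - t * G' w d - c / 2 * q * t ^ 2)
      (Set.Icc 0 1) := by
    apply monotoneOn_of_deriv_nonneg (convex_Icc 0 1)
    · exact fun t _ => (hder t).continuousAt.continuousWithinAt
    · exact fun t _ => (hder t).differentiableAt.differentiableWithinAt
    · intro t ht
      rw [interior_Icc] at ht
      rw [(hder t).deriv]
      have h5 := h t ht.1 ht.2
      rw [map_smul, smul_eq_mul, _root_.sub_apply] at h5
      have h6 : t * (c * q * t) ≤ t * (G' (w + t • d) d - G' w d) := by linarith
      have h7 := le_of_mul_le_mul_left h6 ht.1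
      linarith
  have h8 := hmono (Set.left_mem_Icc.2 zero_le_one) (Set.right_mem_Icc.2 zero_le_one) zero_le_one
  simp at h8
  linarith

lemma upper_bound (G : H → ℝ) (G' : H → H →L[ℝ] ℝ)
    (hdiff : ∀ x : H, HasFDerivAt G (G' x) x) (w d : H) (c q : ℝ)
    (h : ∀ t : ℝ, 0 < t → t < 1 → (G' (w + t • d) - G' w) (t • d) ≤ c * (t ^ 2 * q)) :
    G (w + d) ≤ G w + G' w d + c / 2 * q := by
  have := lower_bound (fun x => - G x) (fun x => - G' x) (fun x => (hdiff x).neg) w d (-c) q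
    (by
      intro t h0 h1
      have := h t h0 h1
      simp only [_root_.sub_apply, _root_.neg_apply] at this ⊢
      linarith)
  simp only [_root_.neg_apply] at this
  linarith

lemma cauchy (L : H →ₗ[ℝ] (H →L[ℝ] ℝ)) (hsymm : ∀ x y : H, L x y = L y x)
    (hpos : ∀ x : H, 0 ≤ L x x) (x y : H) :
    L x y ≤ Real.sqrt (L x x) * Real.sqrt (L y y) := by
  have h : (L x y) ^ 2 ≤ L x x * L y y := by
    have hd := discrim_le_zero (a := L y y) (b := 2 * L x y) (c := L x x) (by
      intro t
      have := hpos (x + t • y)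
      simp only [map_add, map_smul, _root_.add_apply, _root_.smul_apply,
        smul_eq_mul, hsymm y x] at this
      linarith)
    unfold discrim at hd
    linarith
  rw [← Real.sqrt_mul (hpos x)]
  exact Real.le_sqrt_of_sq_le h

lemma tri (L : H →ₗ[ℝ] (H →L[ℝ] ℝ)) (hsymm : ∀ x y : H, L x y = L y x)
    (hpos : ∀ x : H, 0 ≤ L x x) (x y : H) :
    Real.sqrt (L (x + y) (x + y)) ≤ Real.sqrt (L x x) + Real.sqrt (L y y) := by
  apply Real.sqrt_le_iff.2
  refine ⟨by positivity, ?_⟩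
  have h := cauchy L hsymm hpos x y
  have h1 := Real.sq_sqrt (hpos x)
  have h2 := Real.sq_sqrt (hpos y)
  simp only [map_add, _root_.add_apply, hsymm y x]
  nlinarith

lemma sqrt_smul (L : H →ₗ[ℝ] (H →L[ℝ] ℝ)) (t : ℝ) (ht : 0 ≤ t) (x : H) :
    Real.sqrt (L (t • x) (t • x)) = t * Real.sqrt (L x x) := by
  simp only [map_smul, _root_.smul_apply, smul_eq_mul]
  rw [← mul_assoc, Real.sqrt_mul (by positivity), Real.sqrt_mul_self ht]

end PAGDAux

set_option maxHeartbeats 4000000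

/-- exponential decay of the Lyapunov function along PAGD.
With `E(X,V) = (η/2)‖V‖_𝓛² + (1/η)(G(X) − G*)` and
`E₀ = (1/η)(G(x₀) − G*) + (η/2)‖x₀ − x*‖_𝓛²`, under the invariant-set step
size restriction, for all `k ≥ 0`:
`E(x_{k+1}, v_{k+1} − x*) ≤ (1 − θ) E(x_k, v_k − x*)` and
`E(x_k, v_k − x*) ≤ (1 − θ)^k E₀`. -/
theorem PAGD_lyapunov_exponential_decay
    {H : Type*} [NormedAddCommGroup H] [InnerProductSpace ℝ H]
    [CompleteSpace H] [SeparableSpace H]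
    (L : H →ₗ[ℝ] (H →L[ℝ] ℝ))
    (C₁ C₂ : ℝ) (hC₁ : 0 < C₁) (hC₂ : 0 < C₂)
    (hsymm : ∀ x y : H, L x y = L y x)
    (hbdd : ∀ x y : H, L x y ≤ C₂ * ‖x‖ * ‖y‖)
    (hcoer : ∀ x : H, C₁ * ‖x‖ ^ 2 ≤ L x x)
    (Linv : (H →L[ℝ] ℝ) → H)
    (hLinv : ∀ f : H →L[ℝ] ℝ, L (Linv f) = f)
    (hLinv' : ∀ x : H, Linv (L x) = x)
    (G : H → ℝ) (G' : H → H →L[ℝ] ℝ)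
    (hdiff : ∀ x : H, HasFDerivAt G (G' x) x)
    (μ : ℝ) (hμ : 0 < μ)
    -- μ-strong convexity
    (hsc : ∀ x y : H, (G' x - G' y) (x - y) ≥ μ * L (x - y) (x - y))
    -- local Lipschitz smoothness
    (hlip : ∀ B : Set H, Convex ℝ B → Bornology.IsBounded B →
      ∃ LB > (0:ℝ), ∀ x ∈ B, ∀ y ∈ B,
        (G' x - G' y) (x - y) ≤ LB * L (x - y) (x - y))
    -- minimizer and minimum
    (xstar : H) (hmin : ∀ y : H, G xstar ≤ G y)
    (x₀ : H) (r : ℝ) (hr : 1 < r)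
    -- the invariant set 𝔅
    (R₁ R₂ R : ℝ)
    (hR₁ : R₁ = Real.sqrt (2 / μ * (G x₀ - G xstar)))
    (hR₂ : R₂ = Real.sqrt (2 * r * (G x₀ - G xstar)))
    (η : ℝ) (hη : η = Real.sqrt μ)
    (hR : R = R₁ + R₂ / η)
    (𝔅 : Set H)
    (h𝔅 : 𝔅 = {z : H | Real.sqrt (L (z - xstar) (z - xstar)) ≤ R})
    -- L_B : a Lipschitz smoothness constant of G on 𝔅
    (LB : ℝ) (hLB : 0 < LB)
    (hsm : ∀ z ∈ 𝔅, ∀ w ∈ 𝔅, (G' z - G' w) (z - w) ≤ LB * L (z - w) (z - w))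
    -- step size restriction
    (s : ℝ) (hs : 0 < s)
    (hs' : s ≤ min (1 / LB) (((r - 1) / (r + 1)) ^ 2 / μ))
    -- PAGD parameters and iterates
    (θ lam : ℝ) (hθ : θ = η * Real.sqrt s) (hlam : lam = (1 - θ) / (1 + θ))
    (x y v : ℕ → H)
    (hx0 : x 0 = x₀)
    (hy : ∀ k : ℕ, y k = x k + lam • (x k - x (k - 1)))
    (hx : ∀ k : ℕ, x (k + 1) = y k - s • Linv (G' (y k)))
    (hv0 : v 0 = x 0)
    (hv : ∀ k : ℕ, v (k + 1) = x k + (1 / θ) • (x (k + 1) - x k)) :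
    (∀ k : ℕ,
      η / 2 * L (v (k + 1) - xstar) (v (k + 1) - xstar)
          + 1 / η * (G (x (k + 1)) - G xstar)
        ≤ (1 - θ) *
            (η / 2 * L (v k - xstar) (v k - xstar)
              + 1 / η * (G (x k) - G xstar))) ∧
    (∀ k : ℕ,
      η / 2 * L (v k - xstar) (v k - xstar) + 1 / η * (G (x k) - G xstar)
        ≤ (1 - θ) ^ k *
            (1 / η * (G x₀ - G xstar)
              + η / 2 * L (x₀ - xstar) (x₀ - xstar))) := by
  have hpos : ∀ z : H, 0 ≤ L z z := fun z => le_trans (by positivity) (hcoer z)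
  have hηpos : 0 < η := by rw [hη]; exact Real.sqrt_pos.2 hμ
  have hη2 : η ^ 2 = μ := by rw [hη]; exact Real.sq_sqrt hμ.le
  have hθpos : 0 < θ := by rw [hθ]; exact mul_pos hηpos (Real.sqrt_pos.2 hs)
  have hθ2 : θ ^ 2 = μ * s := by rw [hθ, mul_pow, hη2, Real.sq_sqrt hs.le]
  have hsLB : s * LB ≤ 1 := by
    have := hs'.trans (min_le_left _ _)
    rwa [le_div_iff₀ hLB] at this
  have hθ1 : θ < 1 := by
    have h1 := hs'.trans (min_le_right _ _)
    rw [le_div_iff₀ hμ] at h1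
    have h2 : ((r - 1) / (r + 1)) < 1 := by rw [div_lt_one (by linarith)]; linarith
    have h3 : 0 < (r - 1) / (r + 1) := div_pos (by linarith) (by linarith)
    nlinarith
  have hμs : μ * s < 1 := by nlinarith
  have hlam0 : 0 ≤ lam := by rw [hlam]; exact div_nonneg (by linarith) (by linarith)
  have hlam1 : lam ≤ 1 := by rw [hlam, div_le_one (by linarith)]; linarith
  -- strong convexity
  have hlow : ∀ w z : H, G w + G' w (z - w) + μ / 2 * L (z - w) (z - w) ≤ G z := by
    intro w z
    have := PAGDAux.lower_bound G G' hdiff w (z - w) μ (L (z - w) (z - w)) (by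
      intro t _ _
      have h := hsc (w + t • (z - w)) w
      rw [add_sub_cancel_left] at h
      refine le_trans (le_of_eq ?_) h
      simp only [map_smul, _root_.smul_apply, smul_eq_mul]
      ring)
    rwa [add_sub_cancel] at this
  have hG0 : G' xstar = 0 :=
    IsLocalMin.hasFDerivAt_eq_zero (Filter.Eventually.of_forall hmin) (hdiff xstar)
  have hquad : ∀ z : H, μ / 2 * L (z - xstar) (z - xstar) ≤ G z - G xstar := by
    intro z
    have := hlow xstar z
    rw [hG0, _root_.zero_apply] at this
    linarith
  -- convexity of the ball
  have hconv : ∀ w ∈ 𝔅, ∀ z ∈ 𝔅, ∀ t : ℝ, 0 ≤ t → t ≤ 1 → w + t • (z - w) ∈ 𝔅 := by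
    intro w hw z hz t h0 h1
    rw [h𝔅, Set.mem_ofPred_eq] at *
    have e : w + t • (z - w) - xstar = (1 - t) • (w - xstar) + t • (z - xstar) := by module
    rw [e]
    refine (PAGDAux.tri L hsymm hpos _ _).trans ?_
    rw [PAGDAux.sqrt_smul L _ (by linarith), PAGDAux.sqrt_smul L _ h0]
    nlinarith
  have hup : ∀ w ∈ 𝔅, ∀ z ∈ 𝔅, G z ≤ G w + G' w (z - w) + LB / 2 * L (z - w) (z - w) := by
    intro w hw z hz
    have := PAGDAux.upper_bound G G' hdiff w (z - w) LB (L (z - w) (z - w)) (by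
      intro t h0 h1
      have h := hsm (w + t • (z - w)) (hconv w hw z hz t h0.le h1.le) w hw
      rw [add_sub_cancel_left] at h
      refine le_trans h (le_of_eq ?_)
      simp only [map_smul, _root_.smul_apply, smul_eq_mul]
      ring)
    rwa [add_sub_cancel] at this
  have hLg : ∀ f z, L (Linv f) z = f z := fun f z => by rw [hLinv]
  have hLg' : ∀ f z, L z (Linv f) = f z := fun f z => by rw [hsymm, hLinv]
  -- sufficient decrease for a gradient step of length `t ≤ s` staying in the ball
  have hdec : ∀ w ∈ 𝔅, ∀ t : ℝ, 0 ≤ t → t ≤ s → w - t • Linv (G' w) ∈ 𝔅 →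
      G (w - t • Linv (G' w)) ≤ G w - t / 2 * G' w (Linv (G' w)) := by
    intro w hw t h0 h1 hz
    have h := hup w hw _ hz
    have e : w - t • Linv (G' w) - w = (-t) • Linv (G' w) := by module
    rw [e] at h
    simp only [map_smul, _root_.smul_apply, smul_eq_mul, hLg] at h
    have hg : 0 ≤ G' w (Linv (G' w)) := by rw [← hLg]; exact hpos _
    have : t * LB ≤ 1 := le_trans (by nlinarith) hsLB
    nlinarith [mul_nonneg (mul_nonneg h0 hg) (sub_nonneg.2 this)]
  set D := G x₀ - G xstar with hD
  have hD0 : 0 ≤ D := sub_nonneg.2 (hmin _)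
  -- the radius
  have hR' : R = R₁ + Real.sqrt (2 * r * D / μ) := by
    rw [hR, hR₂, hη, Real.sqrt_div (by positivity)]
  have hsD : 2 * s * D ≤ 2 * r * D / μ := by
    rw [le_div_iff₀ hμ]
    nlinarith [mul_nonneg hD0 (by linarith : 0 ≤ r - μ * s)]
  have hRle : R₁ + Real.sqrt (2 * s * D) ≤ R := by
    rw [hR']
    have := Real.sqrt_le_sqrt hsD
    linarith
  have hRlt : 0 < D → R₁ + Real.sqrt (2 * s * D) < R := by
    intro hDp
    rw [hR']
    have : Real.sqrt (2 * s * D) < Real.sqrt (2 * r * D / μ) := by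
      apply Real.sqrt_lt_sqrt (by positivity)
      rw [lt_div_iff₀ hμ]
      nlinarith [mul_pos hDp (by linarith : 0 < r - μ * s)]
    linarith
  have hball : ∀ a z : H, G a - G xstar ≤ D → L (z - a) (z - a) ≤ 2 * s * D →
      Real.sqrt (L (z - xstar) (z - xstar)) ≤ R₁ + Real.sqrt (2 * s * D) := by
    intro a z ha hz
    have e : z - xstar = (a - xstar) + (z - a) := by abel
    rw [e]
    refine (PAGDAux.tri L hsymm hpos _ _).trans ?_
    rw [hR₁]
    refine add_le_add (Real.sqrt_le_sqrt ?_) (Real.sqrt_le_sqrt hz)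
    have := hquad a
    rw [div_mul_eq_mul_div, le_div_iff₀ hμ]
    linarith
  -- key step of the invariance argument
  have hstep : ∀ a b : H, G a - G xstar + 1 / (2 * s) * L (b - a) (b - a) ≤ D →
      b ∈ 𝔅 ∧ b - s • Linv (G' b) ∈ 𝔅 ∧
      G (b - s • Linv (G' b)) - G xstar + 1 / (2 * s) *
        L (b - s • Linv (G' b) - a) (b - s • Linv (G' b) - a) ≤
        G a - G xstar + 1 / (2 * s) * L (b - a) (b - a) := by
    intro a b hab
    have hq := hpos (b - a)
    have hGa := hmin a
    have haD : G a - G xstar ≤ D := by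
      have : 0 ≤ 1 / (2 * s) * L (b - a) (b - a) := by positivity
      linarith
    have hab' : 2 * s * (G a - G xstar) + L (b - a) (b - a) ≤ 2 * s * D := by
      have := mul_le_mul_of_nonneg_left hab (by positivity : 0 ≤ 2 * s)
      have e : 2 * s * (G a - G xstar + 1 / (2 * s) * L (b - a) (b - a)) =
          2 * s * (G a - G xstar) + L (b - a) (b - a) := by field_simp
      linarith
    have hbR' : Real.sqrt (L (b - xstar) (b - xstar)) ≤ R₁ + Real.sqrt (2 * s * D) := by
      apply hball a b haD
      have : 0 ≤ 2 * s * (G a - G xstar) := mul_nonneg (by positivity) (sub_nonneg.2 hGa)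
      linarith
    have hb : b ∈ 𝔅 := by
      rw [h𝔅]; exact hbR'.trans hRle
    -- energy estimate along the gradient step
    have hen : ∀ t : ℝ, 0 ≤ t → t ≤ s → b - t • Linv (G' b) ∈ 𝔅 →
        2 * t * (G (b - t • Linv (G' b)) - G xstar) +
          L (b - t • Linv (G' b) - a) (b - t • Linv (G' b) - a) ≤
          2 * t * (G a - G xstar) + L (b - a) (b - a) := by
      intro t h0 h1 hz
      have h2 := hdec b hb t h0 h1 hz
      have h3 := hlow b a
      have h4 := hpos (a - b)
      have e : b - t • Linv (G' b) - a = (b - a) - t • Linv (G' b) := by abel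
      have e2 : G' b (a - b) = - G' b (b - a) := by rw [← map_neg, neg_sub]
      have h5 : L ((b - a) - t • Linv (G' b)) ((b - a) - t • Linv (G' b)) =
          L (b - a) (b - a) - 2 * t * G' b (b - a) + t ^ 2 * G' b (Linv (G' b)) := by
        rw [map_sub L, _root_.sub_apply, map_sub (L (b - a)),
          map_smul L, _root_.smul_apply, hLg, map_smul, hLg', map_sub (G' b) (b - a),
          map_smul]
        simp only [smul_eq_mul]
        ring
      rw [e, h5]
      have h6 : G (b - t • Linv (G' b)) - G a + t / 2 * G' b (Linv (G' b)) - G' b (b - a) ≤ 0 := by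
        have : 0 ≤ μ / 2 * L (a - b) (a - b) := by positivity
        linarith
      have h7 := mul_nonneg h0 (neg_nonneg.2 h6)
      linarith
    have hnext : b - s • Linv (G' b) ∈ 𝔅 := by
      rcases hD0.eq_or_lt with hDz | hDp
      · have h1 : L (b - xstar) (b - xstar) ≤ 0 := by
          rw [hR₁, ← hDz] at hbR'
          simp only [mul_zero, Real.sqrt_zero, add_zero] at hbR'
          exact Real.sqrt_eq_zero'.1 (le_antisymm hbR' (Real.sqrt_nonneg _))
        have h2 : ‖b - xstar‖ ^ 2 ≤ 0 := by
          have := hcoer (b - xstar)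
          by_contra hc
          push Not at hc
          nlinarith [mul_pos hC₁ hc]
        have h3 : b = xstar := by
          rw [← sub_eq_zero, ← norm_eq_zero]
          exact pow_eq_zero_iff two_ne_zero |>.1 (le_antisymm h2 (by positivity))
        have h4 : Linv (G' b) = 0 := by
          rw [h3, hG0, ← map_zero L, hLinv']
        rw [h4, smul_zero, sub_zero]
        exact hb
      · by_contra hcon
        have hcon' : R < Real.sqrt (L (b - s • Linv (G' b) - xstar) (b - s • Linv (G' b) - xstar)) := by
          rw [h𝔅, Set.mem_ofPred_eq, not_le] at hcon
          exact hcon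
        let φ : ℝ → ℝ := fun t => Real.sqrt (L (b - t • Linv (G' b) - xstar)
          (b - t • Linv (G' b) - xstar))
        have hφ : Continuous φ := by
          apply Real.continuous_sqrt.comp
          have : (fun t : ℝ => L (b - t • Linv (G' b) - xstar) (b - t • Linv (G' b) - xstar)) =
              fun t : ℝ => L (b - xstar) (b - xstar) - 2 * t * G' b (b - xstar)
                + t ^ 2 * G' b (Linv (G' b)) := by
            funext t
            have e : b - t • Linv (G' b) - xstar = (b - xstar) - t • Linv (G' b) := by abel
            rw [e, map_sub L, _root_.sub_apply, map_sub (L (b - xstar)),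
              map_smul L, _root_.smul_apply, hLg, map_smul, hLg', map_sub (G' b) (b - xstar),
              map_smul]
            simp only [smul_eq_mul]
            ring
          rw [this]
          fun_prop
        have h0R : φ 0 ≤ R := by
          have : φ 0 = Real.sqrt (L (b - xstar) (b - xstar)) := by simp [φ]
          rw [this]
          exact hbR'.trans hRle
        obtain ⟨t, ht, hφt⟩ := intermediate_value_Icc hs.le hφ.continuousOn
          (⟨h0R, hcon'.le⟩ : R ∈ Set.Icc (φ 0) (φ s))
        have hmem : b - t • Linv (G' b) ∈ 𝔅 := by
          rw [h𝔅]; exact hφt.le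
        have h1 := hen t ht.1 ht.2 hmem
        have h2 := hmin (b - t • Linv (G' b))
        have h3 : φ t ≤ R₁ + Real.sqrt (2 * s * D) := by
          apply hball a _ haD
          nlinarith [mul_nonneg ht.1 (sub_nonneg.2 h2),
            mul_nonneg (sub_nonneg.2 ht.2) (sub_nonneg.2 hGa)]
        have h4 := hRlt hDp
        linarith
    refine ⟨hb, hnext, ?_⟩
    have h := hen s hs.le le_rfl hnext
    have hfin := mul_le_mul_of_nonneg_left h (by positivity : 0 ≤ 1 / (2 * s))
    have e : ∀ p q : ℝ, 1 / (2 * s) * (2 * s * p + q) = p + 1 / (2 * s) * q := by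
      intro p q; field_simp
    rwa [e, e] at hfin
  -- bounded energy for all iterates
  have hyx : ∀ k, L (y k - x k) (y k - x k) ≤ L (x k - x (k - 1)) (x k - x (k - 1)) := by
    intro k
    rw [hy k, add_sub_cancel_left]
    simp only [map_smul, _root_.smul_apply, smul_eq_mul]
    have h1 := hpos (x k - x (k - 1))
    have : lam * lam ≤ 1 := by nlinarith
    nlinarith
  have hyx' : ∀ k, G (x k) - G xstar + 1 / (2 * s) * L (x k - x (k - 1)) (x k - x (k - 1)) ≤ D →
      G (x k) - G xstar + 1 / (2 * s) * L (y k - x k) (y k - x k) ≤ D := by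
    intro k h
    have := mul_le_mul_of_nonneg_left (hyx k) (by positivity : 0 ≤ 1 / (2 * s))
    linarith
  have hinv : ∀ k, G (x k) - G xstar + 1 / (2 * s) * L (x k - x (k - 1)) (x k - x (k - 1)) ≤ D := by
    intro k
    induction k with
    | zero => simp [hx0, hD]
    | succ k ih =>
      have h1 := hyx' k ih
      have h2 := (hstep _ _ h1).2.2
      rw [Nat.add_sub_cancel, hx k]
      exact h2.trans h1
  have hyv : ∀ k, θ • (v k - y k) = y k - x k := by
    intro k
    have hθ' : (1 + θ) ≠ 0 := by positivity
    cases k with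
    | zero =>
      have : y 0 = x 0 := by rw [hy 0]; simp
      rw [this, hv0]; simp
    | succ k =>
      rw [hy (k + 1), hv k, Nat.add_sub_cancel, hlam]
      match_scalars <;> field_simp <;> ring
  have hvs : ∀ k, v (k + 1) = (1 - θ) • v k + θ • y k - (s / θ) • Linv (G' (y k)) := by
    intro k
    have h1 : x k = y k - θ • (v k - y k) := by rw [hyv k]; abel
    rw [hv k, hx k]
    nth_rewrite 1 [h1]
    rw [h1]
    match_scalars <;> field_simp <;> ring
  have main : ∀ k : ℕ,
      η / 2 * L (v (k + 1) - xstar) (v (k + 1) - xstar)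
          + 1 / η * (G (x (k + 1)) - G xstar)
        ≤ (1 - θ) *
            (η / 2 * L (v k - xstar) (v k - xstar)
              + 1 / η * (G (x k) - G xstar)) := by
    intro k
    obtain ⟨hyB, hxB, -⟩ := hstep _ _ (hyx' k (hinv k))
    have d := hdec _ hyB s hs.le le_rfl hxB
    rw [← hx k] at d
    have c1 := hlow (y k) xstar
    have c2 := hlow (y k) (x k)
    have c3 := hpos (x k - y k)
    have c4 := hpos (v k - y k)
    set g := Linv (G' (y k)) with hg
    set V := v k - xstar with hV
    set a := y k - xstar with ha
    have e1 : v (k + 1) - xstar = ((1 - θ) • V + θ • a) - (s / θ) • g := by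
      rw [hvs k, hV, ha]; module
    have e2 : G' (y k) (x k - y k) = - (θ * (G' (y k) V - G' (y k) a)) := by
      have : x k - y k = -(θ • (V - a)) := by
        rw [hV, ha, sub_sub_sub_cancel_right, hyv k]; abel
      rw [this, map_neg, map_smul, map_sub, smul_eq_mul]
    have e3 : xstar - y k = - a := by rw [ha]; abel
    have e4 : v k - y k = V - a := by rw [hV, ha]; abel
    rw [e3] at c1
    rw [e2] at c2
    rw [e4] at c4
    have e5 : L (v (k + 1) - xstar) (v (k + 1) - xstar) =
        (1 - θ) * L V V + θ * L a a - θ * (1 - θ) * L (V - a) (V - a)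
        - 2 * (s / θ) * ((1 - θ) * G' (y k) V + θ * G' (y k) a)
        + (s / θ) ^ 2 * G' (y k) g := by
      have l1 : ∀ z, L g z = G' (y k) z := hLg _
      have l2 : ∀ z, L z g = G' (y k) z := hLg' _
      rw [e1]
      simp only [map_sub, map_add, map_smul, _root_.sub_apply,
        _root_.add_apply, _root_.smul_apply, smul_eq_mul, l1, l2,
        hsymm a V]
      ring
    have e6 : s / θ = θ / μ := by
      rw [div_eq_div_iff hθpos.ne' hμ.ne']; linarith
    have c5 : μ / 2 * L (v (k + 1) - xstar) (v (k + 1) - xstar) + (G (x (k + 1)) - G xstar) ≤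
        (1 - θ) * (μ / 2 * L V V + (G (x k) - G xstar)) := by
      have e7 : μ / 2 * L (v (k + 1) - xstar) (v (k + 1) - xstar) =
          μ / 2 * ((1 - θ) * L V V + θ * L a a - θ * (1 - θ) * L (V - a) (V - a))
          - θ * ((1 - θ) * G' (y k) V + θ * G' (y k) a) + s / 2 * G' (y k) g := by
        have e8 : s = θ ^ 2 / μ := by rw [hθ2]; field_simp
        rw [e5, e6, e8]; field_simp
      simp only [map_neg, _root_.neg_apply, neg_neg] at c1
      have t1 := mul_le_mul_of_nonneg_left c1 hθpos.le
      have c2' : G (y k) + -(θ * (G' (y k) V - G' (y k) a)) ≤ G (x k) := by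
        have : 0 ≤ μ / 2 * L (x k - y k) (x k - y k) := by positivity
        linarith
      have t2 := mul_le_mul_of_nonneg_left c2' (by linarith : 0 ≤ 1 - θ)
      have t3 : 0 ≤ μ / 2 * (θ * (1 - θ) * L (V - a) (V - a)) := by
        have : 0 ≤ 1 - θ := by linarith
        positivity
      rw [e7]
      linarith
    have c6 := mul_le_mul_of_nonneg_left c5 (by positivity : 0 ≤ 1 / η)
    rw [← hη2] at c6
    have e9 : ∀ p q : ℝ, 1 / η * (η ^ 2 / 2 * p + q) = η / 2 * p + 1 / η * q := by
      intro p q; field_simp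
    rw [e9, mul_left_comm, e9] at c6
    exact c6
  refine ⟨main, ?_⟩
  intro k
  induction k with
  | zero => rw [hv0, hx0, pow_zero, one_mul, add_comm]
  | succ k ih =>
    refine (main k).trans ?_
    rw [pow_succ', mul_assoc]
    exact mul_le_mul_of_nonneg_left ih (by linarith)
end

section
/- Let G : H → ℝ be μ-strongly convex and locally Lipschitz smooth, with minimizer x* and minimum G*, and run PAGD with friction η = √μ and step size s = 1/L_B, where L_B is a Lipschitz smoothness constant of G on the invariant set 𝔅 and s = 1/L_B satisfies the step size restriction s ≤ ((r−1)/(r+1))²/μ for some r > 1. Set ρ := μ/L_B. Then for all k ≥ 0: (1/η)(G(x_k) − G*) + (η/2)‖v_k − x*‖_𝓛² ≤ (1 − √ρ)^k E₀; consequently G(x_k) − G* ≤ (1 − √ρ)^k η E₀ and ‖x_k − x*‖_𝓛 ≤ (1 − √ρ)^{k/2} √(2E₀/η). -/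
open TopologicalSpace

theorem PAGD_taylor_upper {H : Type*} [NormedAddCommGroup H] [InnerProductSpace ℝ H]
    (G : H → ℝ) (G' : H → H →L[ℝ] ℝ) (hdiff : ∀ x : H, HasFDerivAt G (G' x) x)
    (u d : H) (c : ℝ)
    (h : ∀ t : ℝ, 0 < t → t < 1 → (G' (u + t • d) - G' u) d ≤ c * t) :
    G (u + d) ≤ G u + G' u d + c / 2 := by
  have hline : ∀ t : ℝ, HasDerivAt (fun t : ℝ => u + t • d) d t := by
    intro t
    simpa using ((hasDerivAt_id t).smul_const d).const_add u
  have hder : ∀ t : ℝ, HasDerivAt (fun t : ℝ => G (u + t • d) - t * G' u d - c / 2 * t ^ 2)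
      (G' (u + t • d) d - 1 * G' u d - c / 2 * (2 * t)) t := by
    intro t
    have h1 := (hdiff (u + t • d)).comp_hasDerivAt t (hline t)
    have h2 := ((hasDerivAt_id t).mul_const (G' u d))
    have h3 := (hasDerivAt_pow 2 t).const_mul (c / 2)
    have h4 := (h1.sub h2).sub h3
    refine h4.congr_deriv ?_
    simp
  have hanti : AntitoneOn (fun t : ℝ => G (u + t • d) - t * G' u d - c / 2 * t ^ 2)
      (Set.Icc 0 1) := by
    apply antitoneOn_of_deriv_nonpos (convex_Icc 0 1)
    · exact fun t _ => (hder t).continuousAt.continuousWithinAt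
    · exact fun t _ => (hder t).differentiableAt.differentiableWithinAt
    · intro t ht
      rw [interior_Icc] at ht
      rw [(hder t).deriv]
      have := h t ht.1 ht.2
      rw [sub_apply] at this
      linarith
  have := hanti (Set.left_mem_Icc.2 zero_le_one) (Set.right_mem_Icc.2 zero_le_one) zero_le_one
  simp at this
  linarith

theorem PAGD_taylor_lower {H : Type*} [NormedAddCommGroup H] [InnerProductSpace ℝ H]
    (G : H → ℝ) (G' : H → H →L[ℝ] ℝ) (hdiff : ∀ x : H, HasFDerivAt G (G' x) x)
    (u d : H) (c : ℝ)
    (h : ∀ t : ℝ, 0 < t → t < 1 → c * t ≤ (G' (u + t • d) - G' u) d) :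
    G u + G' u d + c / 2 ≤ G (u + d) := by
  have := PAGD_taylor_upper (fun x => - G x) (fun x => - G' x) (fun x => (hdiff x).neg) u d (-c)
    (by
      intro t h0 h1
      have := h t h0 h1
      simp at this ⊢
      linarith)
  simp at this
  linarith

/-- A gradient step from a point strictly inside the ball stays in the ball and descends. -/
theorem PAGD_descent {H : Type*} [NormedAddCommGroup H] [InnerProductSpace ℝ H]
    (L : H →ₗ[ℝ] (H →L[ℝ] ℝ))
    (hsymm : ∀ x y : H, L x y = L y x) (hpos : ∀ x : H, 0 ≤ L x x)
    (G : H → ℝ) (G' : H → H →L[ℝ] ℝ)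
    (hdiff : ∀ x : H, HasFDerivAt G (G' x) x)
    (hconv : ∀ u d : H, G u + G' u d ≤ G (u + d))
    (xstar : H) (hmin : ∀ y : H, G xstar ≤ G y)
    (Q LB s : ℝ) (hLB : 0 < LB) (hs : s = 1 / LB)
    (hsm : ∀ z w : H, L (z - xstar) (z - xstar) ≤ Q → L (w - xstar) (w - xstar) ≤ Q →
      (G' z - G' w) (z - w) ≤ LB * L (z - w) (z - w))
    (y g : H) (hg : L g = G' y)
    (hy : L (y - xstar) (y - xstar) < Q) :
    G (y - s • g) ≤ G y - s / 2 * L g g := by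
  have hspos : 0 < s := by rw [hs]; positivity
  have hsLB : s * LB = 1 := by rw [hs]; field_simp
  obtain ⟨b, hb⟩ : ∃ b, b = y - xstar := ⟨_, rfl⟩
  have hq : ∀ t : ℝ, L (y - t • g - xstar) (y - t • g - xstar)
      = L b b - 2 * t * L g b + t ^ 2 * L g g := by
    intro t
    have : y - t • g - xstar = b - t • g := by rw [hb]; abel
    rw [this]
    simp only [map_sub, map_smul, sub_apply, smul_apply,
      smul_eq_mul, hsymm b g]
    ring
  rw [← hb] at hy
  have hgg := hpos g
  -- descent for any admissible t
  have hdesc : ∀ t : ℝ, 0 ≤ t → L b b - 2 * t * L g b + t ^ 2 * L g g ≤ Q →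
      G (y - t • g) ≤ G y - (t - LB * t ^ 2 / 2) * L g g := by
    intro t ht hQ
    have h := PAGD_taylor_upper G G' hdiff y (-(t • g)) (LB * t ^ 2 * L g g) (by
      intro τ h0 h1
      have e : y + τ • -(t • g) = y - (τ * t) • g := by
        rw [smul_neg, smul_smul, ← sub_eq_add_neg]
      have hm := hsm (y - (τ * t) • g) y (by
        rw [hq]
        have : L b b - 2 * (τ * t) * L g b + (τ * t) ^ 2 * L g g
          ≤ (1 - τ) * L b b + τ * (L b b - 2 * t * L g b + t ^ 2 * L g g) := by
          have : 0 ≤ τ * (1 - τ) * (t ^ 2 * L g g) := by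
            have : 0 < 1 - τ := by linarith
            positivity
          nlinarith
        nlinarith) (by rw [← hb]; exact hy.le)
      rw [e]
      have e2 : y - (τ * t) • g - y = τ • -(t • g) := by
        rw [smul_neg, smul_smul]; abel
      rw [e2] at hm
      rw [map_smul (G' (y - (τ * t) • g) - G' y)] at hm
      simp only [map_smul, map_neg, smul_apply, neg_apply,
        smul_eq_mul] at hm ⊢
      have : τ * (-(t * (G' (y - (τ * t) • g) - G' y) g)) ≤ τ * (LB * t ^ 2 * L g g * τ) := by
        linarith
      exact le_of_mul_le_mul_left this h0)
    rw [← sub_eq_add_neg, map_neg, map_smul, ← hg, smul_eq_mul] at h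
    linarith
  have hGb : G y - G xstar ≤ L g b := by
    have := hconv y (-b)
    rw [hb, map_neg, neg_sub, add_sub_cancel, ← hb, ← hg] at this
    linarith
  have hin : L b b - 2 * s * L g b + s ^ 2 * L g g ≤ Q := by
    by_contra hcon
    push Not at hcon
    have hcont : ContinuousOn (fun t : ℝ => L b b - 2 * t * L g b + t ^ 2 * L g g)
      (Set.Icc 0 s) := by fun_prop
    have hQmem : Q ∈ Set.image (fun t : ℝ => L b b - 2 * t * L g b + t ^ 2 * L g g)
        (Set.Icc 0 s) := by
      apply intermediate_value_Icc hspos.le hcont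
      constructor
      · simp; linarith
      · exact hcon.le
    obtain ⟨t, ⟨ht0, hts⟩, hqt⟩ := hQmem
    simp only at hqt
    have h1 := hdesc t ht0 hqt.le
    have h2 := hmin (y - t • g)
    have h3 : LB * t ≤ 1 := by nlinarith
    have h4 : t / 2 ≤ t - LB * t ^ 2 / 2 := by nlinarith
    have h5 : t / 2 * L g g ≤ L g b := by nlinarith
    nlinarith
  have := hdesc s hspos.le hin
  have e : s - LB * s ^ 2 / 2 = s / 2 := by
    linear_combination (-s / 2) * hsLB
  rwa [e] at this

theorem PAGD_energy {H : Type*} [NormedAddCommGroup H] [InnerProductSpace ℝ H]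
    (L : H →ₗ[ℝ] (H →L[ℝ] ℝ))
    (hsymm : ∀ x y : H, L x y = L y x) (hpos : ∀ x : H, 0 ≤ L x x)
    (G : H → ℝ) (G' : H → H →L[ℝ] ℝ) (μ : ℝ) (hμ : 0 < μ)
    (hsc : ∀ u d : H, G u + G' u d + μ / 2 * L d d ≤ G (u + d))
    (xstar : H) (s θ : ℝ) (hθ0 : 0 < θ) (hθ1 : θ < 1) (hθs : θ ^ 2 = μ * s)
    (x y v v' g : H) (hg : L g = G' y)
    (hxy : x - y = θ • (y - v))
    (hv' : v' = (1 - θ) • v + θ • y - (θ / μ) • g)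
    (x' : H) (hdesc : G x' ≤ G y - s / 2 * L g g) :
    G x' - G xstar + μ / 2 * L (v' - xstar) (v' - xstar)
      ≤ (1 - θ) * (G x - G xstar + μ / 2 * L (v - xstar) (v - xstar)) := by
  obtain ⟨b, hb⟩ : ∃ b, b = y - xstar := ⟨_, rfl⟩
  obtain ⟨a, ha⟩ : ∃ a, a = v - xstar := ⟨_, rfl⟩
  have h1 := hsc y (x - y)
  have h2 := hsc y (-b)
  have e1 : x - y = θ • (b - a) := by rw [hxy, hb, ha]; congr 1; abel
  have e2 : v' - xstar = (1 - θ) • a + θ • b - (θ / μ) • g := by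
    rw [hv', hb, ha]; module
  rw [add_sub_cancel] at h1
  have e3 : y + -b = xstar := by rw [hb]; abel
  rw [e3] at h2
  rw [e2, ← ha]
  have hp := hpos (x - y)
  have hab := hpos (a - b)
  have h1' : G y + G' y (x - y) ≤ G x := by nlinarith
  rw [e1] at h1'
  rw [← hg] at h1' h2
  simp only [map_sub, map_add, map_neg, map_smul, sub_apply,
    add_apply, neg_apply,
    smul_apply, smul_eq_mul, hsymm b a, hsymm a g, hsymm b g]
      at h1' h2 hab ⊢
  have hk : μ * (θ / μ) = θ := by field_simp
  have hk2 : μ * (θ / μ) ^ 2 = s := by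
    field_simp; linarith
  have m1 := mul_le_mul_of_nonneg_left h1' (by linarith : 0 ≤ 1 - θ)
  have m2 := mul_le_mul_of_nonneg_left h2 hθ0.le
  have m3 : 0 ≤ μ / 2 * (θ * (1 - θ)) * (L a a - L a b - (L a b - L b b)) := by
    apply mul_nonneg _ hab
    have : 0 < 1 - θ := by linarith
    positivity
  generalize θ / μ = κ at *
  have hfin : μ / 2 * ((1 - θ) * ((1 - θ) * L a a + θ * L a b - κ * L g a) + θ * ((1 - θ) * L a b + θ * L b b - κ * L g b) - κ * ((1 - θ) * L g a + θ * L g b - κ * L g g))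
    = μ / 2 * ((1 - θ) ^ 2 * L a a + 2 * θ * (1 - θ) * L a b + θ ^ 2 * L b b)
      - θ * ((1 - θ) * L g a + θ * L g b) + s / 2 * L g g := by
    linear_combination (-((1 - θ) * L g a + θ * L g b)) * hk + (1/2) * L g g * hk2
  linarith



set_option maxHeartbeats 2000000 in
/-- rate of convergence of PAGD with step size `s = 1/L_B`.
With `ρ = μ/L_B`, for all `k ≥ 0`:
`(1/η)(G(x_k) − G*) + (η/2)‖v_k − x*‖_𝓛² ≤ (1 − √ρ)^k E₀`,
hence `G(x_k) − G* ≤ (1 − √ρ)^k η E₀` and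
`‖x_k − x*‖_𝓛 ≤ (1 − √ρ)^{k/2} √(2E₀/η)`. -/
theorem PAGD_rate_of_convergence
    {H : Type*} [NormedAddCommGroup H] [InnerProductSpace ℝ H]
    [CompleteSpace H] [SeparableSpace H]
    (L : H →ₗ[ℝ] (H →L[ℝ] ℝ))
    (C₁ C₂ : ℝ) (hC₁ : 0 < C₁) (hC₂ : 0 < C₂)
    (hsymm : ∀ x y : H, L x y = L y x)
    (hbdd : ∀ x y : H, L x y ≤ C₂ * ‖x‖ * ‖y‖)
    (hcoer : ∀ x : H, C₁ * ‖x‖ ^ 2 ≤ L x x)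
    (Linv : (H →L[ℝ] ℝ) → H)
    (hLinv : ∀ f : H →L[ℝ] ℝ, L (Linv f) = f)
    (hLinv' : ∀ x : H, Linv (L x) = x)
    (G : H → ℝ) (G' : H → H →L[ℝ] ℝ)
    (hdiff : ∀ x : H, HasFDerivAt G (G' x) x)
    (μ : ℝ) (hμ : 0 < μ)
    -- μ-strong convexity
    (hsc : ∀ x y : H, (G' x - G' y) (x - y) ≥ μ * L (x - y) (x - y))
    -- local Lipschitz smoothness
    (hlip : ∀ B : Set H, Convex ℝ B → Bornology.IsBounded B →
      ∃ LB > (0:ℝ), ∀ x ∈ B, ∀ y ∈ B,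
        (G' x - G' y) (x - y) ≤ LB * L (x - y) (x - y))
    -- minimizer and minimum
    (xstar : H) (hmin : ∀ y : H, G xstar ≤ G y)
    (x₀ : H) (r : ℝ) (hr : 1 < r)
    -- the invariant set 𝔅
    (R₁ R₂ R : ℝ)
    (hR₁ : R₁ = Real.sqrt (2 / μ * (G x₀ - G xstar)))
    (hR₂ : R₂ = Real.sqrt (2 * r * (G x₀ - G xstar)))
    (η : ℝ) (hη : η = Real.sqrt μ)
    (hR : R = R₁ + R₂ / η)
    (𝔅 : Set H)
    (h𝔅 : 𝔅 = {z : H | Real.sqrt (L (z - xstar) (z - xstar)) ≤ R})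
    -- L_B : a Lipschitz smoothness constant of G on 𝔅
    (LB : ℝ) (hLB : 0 < LB)
    (hsm : ∀ z ∈ 𝔅, ∀ w ∈ 𝔅, (G' z - G' w) (z - w) ≤ LB * L (z - w) (z - w))
    -- step size restriction
    (s : ℝ) (hsdef : s = 1 / LB)
    (hs' : s ≤ ((r - 1) / (r + 1)) ^ 2 / μ)
    (ρ : ℝ) (hρ : ρ = μ / LB)
    (E₀ : ℝ)
    (hE₀ : E₀ = 1 / η * (G x₀ - G xstar)
                  + η / 2 * L (x₀ - xstar) (x₀ - xstar))
    -- PAGD parameters and iterates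
    (θ lam : ℝ) (hθ : θ = η * Real.sqrt s) (hlam : lam = (1 - θ) / (1 + θ))
    (x y v : ℕ → H)
    (hx0 : x 0 = x₀)
    (hy : ∀ k : ℕ, y k = x k + lam • (x k - x (k - 1)))
    (hx : ∀ k : ℕ, x (k + 1) = y k - s • Linv (G' (y k)))
    (hv0 : v 0 = x 0)
    (hv : ∀ k : ℕ, v (k + 1) = x k + (1 / θ) • (x (k + 1) - x k)) :
    ∀ k : ℕ,
      (1 / η * (G (x k) - G xstar)
          + η / 2 * L (v k - xstar) (v k - xstar)
        ≤ (1 - Real.sqrt ρ) ^ k * E₀) ∧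
      (G (x k) - G xstar ≤ (1 - Real.sqrt ρ) ^ k * η * E₀) ∧
      (Real.sqrt (L (x k - xstar) (x k - xstar))
        ≤ Real.sqrt ((1 - Real.sqrt ρ) ^ k) * Real.sqrt (2 * E₀ / η)) := by
  have hpos : ∀ z : H, 0 ≤ L z z := fun z =>
    le_trans (by positivity) (hcoer z)
  have hzero : ∀ z : H, L z z ≤ 0 → z = 0 := by
    intro z hz
    have h1 := hcoer z
    have h2 : ‖z‖ ^ 2 ≤ 0 := by
      by_contra hc
      push Not at hc
      have := mul_pos hC₁ hc
      linarith
    have h3 : ‖z‖ = 0 := by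
      have := sq_nonneg ‖z‖
      exact pow_eq_zero_iff (two_ne_zero) |>.1 (le_antisymm h2 this)
    exact norm_eq_zero.1 h3
  have hlow : ∀ u d : H, G u + G' u d + μ / 2 * L d d ≤ G (u + d) := by
    intro u d
    have := PAGD_taylor_lower G G' hdiff u d (μ * L d d) (by
      intro t h0 h1
      have h := hsc (u + t • d) u
      rw [add_sub_cancel_left, map_smul (G' (u + t • d) - G' u)] at h
      simp only [map_smul, smul_apply, smul_eq_mul] at h
      have : t * (μ * L d d * t) ≤ t * (G' (u + t • d) - G' u) d := by linarith
      exact le_of_mul_le_mul_left this h0)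
    linarith
  have hstar : G' xstar = 0 :=
    IsLocalMin.hasFDerivAt_eq_zero (Filter.Eventually.of_forall hmin) (hdiff xstar)
  have hgrow : ∀ z : H, μ / 2 * L (z - xstar) (z - xstar) ≤ G z - G xstar := by
    intro z
    have := hlow xstar (z - xstar)
    rw [hstar, add_sub_cancel, zero_apply] at this
    linarith
  have hηpos : 0 < η := by rw [hη]; exact Real.sqrt_pos.2 hμ
  have hη2 : η ^ 2 = μ := by rw [hη]; exact Real.sq_sqrt hμ.le
  have hspos : 0 < s := by rw [hsdef]; positivity
  have hθ0 : 0 < θ := by rw [hθ]; exact mul_pos hηpos (Real.sqrt_pos.2 hspos)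
  have hθs : θ ^ 2 = μ * s := by
    rw [hθ, mul_pow, hη2, Real.sq_sqrt hspos.le]
  have hθ1 : θ < 1 := by
    have h1 : μ * s ≤ ((r - 1) / (r + 1)) ^ 2 := by
      rw [le_div_iff₀ hμ] at hs'
      linarith
    have h2 : (r - 1) / (r + 1) < 1 := by
      rw [div_lt_one (by linarith)]; linarith
    have h3 : 0 ≤ (r - 1) / (r + 1) := div_nonneg (by linarith) (by linarith)
    nlinarith
  have hρθ : Real.sqrt ρ = θ := by
    have : ρ = θ ^ 2 := by rw [hθs, hρ, hsdef]; ring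
    rw [this, Real.sqrt_sq hθ0.le]
  rw [hρθ]
  obtain ⟨D, hD⟩ : ∃ D, D = G x₀ - G xstar := ⟨_, rfl⟩
  have hD0 : 0 ≤ D := by rw [hD]; linarith [hmin x₀]
  -- the radius
  have hR₁0 : 0 ≤ R₁ := by rw [hR₁]; positivity
  have hR₁2 : R₁ ^ 2 = 2 / μ * D := by
    rw [hR₁, ← hD]; exact Real.sq_sqrt (by positivity)
  have hR12 : R₁ ≤ R₂ / η := by
    rw [hR₁, hR₂, hη, ← Real.sqrt_div' _ hμ.le, ← hD]
    apply Real.sqrt_le_sqrt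
    rw [div_mul_eq_mul_div]
    apply div_le_div_of_nonneg_right _ hμ.le
    nlinarith
  have hR0 : 0 ≤ R := by rw [hR]; linarith
  have hRsq : 8 * D ≤ μ * R ^ 2 := by
    have h1 : 2 * R₁ ≤ R := by rw [hR]; linarith
    have h2 : (2 * R₁) ^ 2 ≤ R ^ 2 := by gcongr
    have h3 : μ * (2 * R₁) ^ 2 = 8 * D := by
      rw [mul_pow, hR₁2]; field_simp; ring
    nlinarith
  have hmem : ∀ z : H, L (z - xstar) (z - xstar) ≤ R ^ 2 → z ∈ 𝔅 := by
    intro z hz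
    rw [h𝔅]
    exact Real.sqrt_le_iff.2 ⟨hR0, hz⟩
  have hxy : ∀ k, x k - y k = θ • (y k - v k) := by
    intro k
    cases k with
    | zero => rw [hy 0, hv0]; simp
    | succ n =>
      rw [hy (n + 1), hv n, Nat.add_sub_cancel, hlam]
      have : (1 + θ) ≠ 0 := by positivity
      match_scalars <;> field_simp <;> ring
  have hA0 : η * E₀ = D + μ / 2 * L (x₀ - xstar) (x₀ - xstar) := by
    rw [hE₀, ← hD, ← hη2]; field_simp
  have hA02 : η * E₀ ≤ 2 * D := by
    rw [hA0]; linarith [hgrow x₀]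
  have hA0nn : 0 ≤ η * E₀ := by
    rw [hA0]; have := hpos (x₀ - xstar); positivity
  have main : ∀ k, G (x k) - G xstar + μ / 2 * L (v k - xstar) (v k - xstar)
      ≤ (1 - θ) ^ k * (η * E₀) := by
    intro k
    induction k with
    | zero => rw [hv0, hx0, hA0, hD]; simp
    | succ k ih =>
      have hA : G (x k) - G xstar + μ / 2 * L (v k - xstar) (v k - xstar) ≤ 2 * D := by
        have h1 : (1 - θ) ^ k ≤ 1 := pow_le_one₀ (by linarith) (by linarith)
        have h2 := mul_le_mul_of_nonneg_right h1 hA0nn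
        linarith
      -- y k is inside
      have hyb : μ / 2 * L (y k - xstar) (y k - xstar) ≤ 2 * D := by
        obtain ⟨p, hp⟩ : ∃ p, p = x k - xstar := ⟨_, rfl⟩
        obtain ⟨a, ha⟩ : ∃ a, a = v k - xstar := ⟨_, rfl⟩
        obtain ⟨b, hb⟩ : ∃ b, b = y k - xstar := ⟨_, rfl⟩
        have h1 := hgrow (x k)
        have hFx := hmin (x k)
        rw [← hp] at h1
        rw [← ha] at hA
        have hpp := hpos p
        have haa := hpos a
        have e : (1 + θ) • b = p + θ • a := by
          have := hxy k
          have e2 : x k = y k + θ • (y k - v k) := by rw [← this]; abel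
          rw [hp, ha, hb, e2]; module
        have e3 : L ((1 + θ) • b) ((1 + θ) • b) = L (p + θ • a) (p + θ • a) := by rw [e]
        have hpa := hpos (p - a)
        simp only [map_sub, map_add, map_smul, sub_apply, add_apply, smul_apply, smul_eq_mul,
          hsymm a p] at e3 hpa
        rw [← hb]
        have i1 : μ / 2 * L p p ≤ 2 * D := by
          have : 0 ≤ μ / 2 * L a a := by positivity
          linarith
        have i2 : μ / 2 * L a a ≤ 2 * D := by linarith
        have i3 : (1 + θ) * L b b ≤ L p p + θ * L a a := by
          have : (1 + θ) * ((1 + θ) * L b b) ≤ (1 + θ) * (L p p + θ * L a a) := by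
            have := mul_nonneg hθ0.le hpa
            rw [e3]
            linarith
          exact le_of_mul_le_mul_left this (by linarith)
        have i4 : (1 + θ) * (μ / 2 * L b b) ≤ (1 + θ) * (2 * D) := by
          have j1 := mul_le_mul_of_nonneg_left i3 (by positivity : 0 ≤ μ / 2)
          have j2 := mul_le_mul_of_nonneg_left i2 hθ0.le
          linarith
        exact le_of_mul_le_mul_left i4 (by linarith)
      have hdesc : G (x (k + 1)) ≤ G (y k) - s / 2 * L (Linv (G' (y k))) (Linv (G' (y k))) := by
        by_cases hb : y k = xstar
        · have : Linv (G' (y k)) = 0 := by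
            rw [hb, hstar, ← map_zero L, hLinv']
          rw [hx k, this]; simp
        · have hDpos : 0 < D := by
            rcases hD0.lt_or_eq with h | h
            · exact h
            · exfalso
              apply hb
              have : L (y k - xstar) (y k - xstar) ≤ 0 := by
                by_contra hc
                push Not at hc
                have := mul_pos hμ hc
                linarith
              exact sub_eq_zero.1 (hzero _ this)
          rw [hx k]
          refine PAGD_descent L hsymm hpos G G' hdiff ?_ xstar hmin (R ^ 2) LB s hLB hsdef ?_
            (y k) _ (hLinv _) ?_
          · intro u d
            have := hlow u d
            have h2 : 0 ≤ μ / 2 * L d d := mul_nonneg (by positivity) (hpos d)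
            linarith
          · exact fun z w hz hw => hsm z (hmem z hz) w (hmem w hw)
          · have : μ * L (y k - xstar) (y k - xstar) < μ * R ^ 2 := by linarith
            exact lt_of_mul_lt_mul_left this hμ.le
      have hv' : v (k + 1) = (1 - θ) • v k + θ • y k - (θ / μ) • Linv (G' (y k)) := by
        have e2 : x k = y k + θ • (y k - v k) := by rw [← hxy k]; abel
        have hsθ : s = θ * (θ / μ) := by field_simp; linarith
        rw [hv k, hx k, e2, hsθ]
        match_scalars <;> field_simp <;> ring
      have hen := PAGD_energy L hsymm hpos G G' μ hμ hlow xstar s θ hθ0 hθ1 hθs (x k) (y k) (v k)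
        (v (k + 1)) (Linv (G' (y k))) (hLinv _) (hxy k) hv' (x (k + 1)) hdesc
      refine hen.trans ?_
      rw [pow_succ]
      have := mul_le_mul_of_nonneg_left ih (by linarith : 0 ≤ 1 - θ)
      linarith
  intro k
  have hk := main k
  have hvv := hpos (v k - xstar)
  have hsec : G (x k) - G xstar ≤ (1 - θ) ^ k * η * E₀ := by
    have : 0 ≤ μ / 2 * L (v k - xstar) (v k - xstar) := by positivity
    linarith
  have hpk : 0 ≤ (1 - θ) ^ k := pow_nonneg (by linarith) k
  refine ⟨?_, hsec, ?_⟩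
  · have e : 1 / η * (G (x k) - G xstar) + η / 2 * L (v k - xstar) (v k - xstar)
        = (G (x k) - G xstar + μ / 2 * L (v k - xstar) (v k - xstar)) / η := by
      rw [← hη2]; field_simp
    rw [e, div_le_iff₀ hηpos]
    linarith
  · rw [← Real.sqrt_mul hpk]
    apply Real.sqrt_le_sqrt
    have h1 := hgrow (x k)
    have h2 : (1 - θ) ^ k * (2 * E₀ / η) = 2 * ((1 - θ) ^ k * η * E₀) / μ := by
      rw [← hη2]; field_simp
    rw [h2, le_div_iff₀ hμ]
    linarith
end

section
/- Let G : H → ℝ be μ-strongly convex and locally Lipschitz smooth, with minimizer x* and minimum G*, and run PAGD with friction η = √μ and step size s = 1/L_B, where L_B is a Lipschitz smoothness constant of G on the invariant set 𝔅 and s = 1/L_B satisfies the step size restriction s ≤ ((r−1)/(r+1))²/μ for some r > 1. Set ρ := μ/L_B. Then the residuals converge to zero exponentially in the 𝓛⁻¹-norm: for all k ≥ 0, ‖G'(y_k)‖_{𝓛⁻¹} ≤ 3 L_B √(2E₀/η) (1 − √ρ)^{(k−1)/2}; moreover, ‖G'(y_k)‖_{𝓛⁻¹} ≤ √(2 L_B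 (G(y_k) − G*)) ≤ L_B ‖y_k − x*‖_𝓛. -/
open TopologicalSpace

section helpers

variable {H : Type*} [NormedAddCommGroup H] [InnerProductSpace ℝ H]

theorem pagd_segment_bound (G : H → ℝ) (G' : H → H →L[ℝ] ℝ)
    (hdiff : ∀ x : H, HasFDerivAt G (G' x) x) (z d : H) (c : ℝ)
    (h : ∀ t : ℝ, 0 < t → t < 1 → (G' (z + t • d) - G' z) (t • d) ≤ t ^ 2 * c) :
    G (z + d) ≤ G z + G' z d + c / 2 := by
  have hder : ∀ t : ℝ, HasDerivAt
      (fun t : ℝ => G (z + t • d) - t * G' z d - t ^ 2 * (c / 2))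
      (G' (z + t • d) d - G' z d - t * c) t := by
    intro t
    have h1 : HasDerivAt (fun t : ℝ => z + t • d) d t := by
      simpa using ((hasDerivAt_id t).smul_const d).const_add z
    have h2 : HasDerivAt (fun t : ℝ => G (z + t • d)) (G' (z + t • d) d) t :=
      (hdiff (z + t • d)).comp_hasDerivAt t h1
    have h3 : HasDerivAt (fun t : ℝ => t * G' z d) (G' z d) t := by
      simpa using (hasDerivAt_id t).mul_const (G' z d)
    have h4 : HasDerivAt (fun t : ℝ => t ^ 2 * (c / 2)) (t * c) t := by
      have := (hasDerivAt_pow 2 t).mul_const (c / 2)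
      refine this.congr_deriv ?_
      norm_num
      ring
    exact (h2.sub h3).sub h4
  have hanti : AntitoneOn (fun t : ℝ => G (z + t • d) - t * G' z d - t ^ 2 * (c / 2))
      (Set.Icc 0 1) := by
    apply antitoneOn_of_deriv_nonpos (convex_Icc 0 1)
    · intro t _
      exact (hder t).continuousAt.continuousWithinAt
    · intro t _
      exact (hder t).differentiableAt.differentiableWithinAt
    · intro t ht
      rw [interior_Icc] at ht
      rw [(hder t).deriv]
      have h1 := h t ht.1 ht.2
      simp only [map_smul, sub_apply, smul_eq_mul] at h1
      have h2 : t * (G' (z + t • d) d - G' z d - t * c) ≤ 0 := by nlinarith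
      by_contra hc
      push Not at hc
      have := mul_pos ht.1 hc
      linarith
  have := hanti (Set.left_mem_Icc.2 zero_le_one) (Set.right_mem_Icc.2 zero_le_one) zero_le_one
  simp at this
  linarith

variable (L : H →ₗ[ℝ] (H →L[ℝ] ℝ))

theorem pagd_strong_lower (G : H → ℝ) (G' : H → H →L[ℝ] ℝ)
    (hdiff : ∀ x : H, HasFDerivAt G (G' x) x) (μ : ℝ)
    (hsc : ∀ x y : H, (G' x - G' y) (x - y) ≥ μ * L (x - y) (x - y)) (z w : H) :
    G z + G' z (w - z) + μ / 2 * L (w - z) (w - z) ≤ G w := by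
  have := pagd_segment_bound (fun x => - G x) (fun x => - G' x)
    (fun x => (hdiff x).neg) z (w - z) (-(μ * L (w - z) (w - z))) (by
      intro t ht ht1
      have h1 := hsc (z + t • (w - z)) z
      rw [add_sub_cancel_left] at h1
      simp only [map_smul, sub_apply, smul_eq_mul, smul_apply, neg_apply] at h1 ⊢
      nlinarith)
  simp only [add_sub_cancel, neg_apply] at this
  linarith

theorem pagd_q_comb (hsymm : ∀ x y : H, L x y = L y x) (a b : H) (t : ℝ) :
    L ((1 - t) • a + t • b) ((1 - t) • a + t • b)
      = (1 - t) * L a a + t * L b b - t * (1 - t) * L (a - b) (a - b) := by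
  simp only [map_add, map_sub, map_smul, add_apply, sub_apply, smul_apply, smul_eq_mul]
  rw [hsymm b a]
  ring

theorem pagd_q_conv (hsymm : ∀ x y : H, L x y = L y x) (hnn : ∀ x : H, 0 ≤ L x x)
    (a b : H) (t : ℝ) (h0 : 0 ≤ t) (h1 : t ≤ 1) :
    L ((1 - t) • a + t • b) ((1 - t) • a + t • b) ≤ (1 - t) * L a a + t * L b b := by
  rw [pagd_q_comb L hsymm]
  have := mul_nonneg (mul_nonneg h0 (sub_nonneg.2 h1)) (hnn (a - b))
  linarith

theorem pagd_q_expand (hsymm : ∀ x y : H, L x y = L y x) (a b : H) (t : ℝ) :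
    L (a - t • b) (a - t • b) = L a a - 2 * t * L b a + t ^ 2 * L b b := by
  simp only [map_sub, map_smul, sub_apply, smul_apply, smul_eq_mul]
  rw [hsymm a b]
  ring

/-- descent lemma inside the ball -/
theorem pagd_smooth_upper (hsymm : ∀ x y : H, L x y = L y x) (hnn : ∀ x : H, 0 ≤ L x x)
    (G : H → ℝ) (G' : H → H →L[ℝ] ℝ)
    (hdiff : ∀ x : H, HasFDerivAt G (G' x) x) (xs : H) (Q LB : ℝ)
    (hsm : ∀ z w : H, L (z - xs) (z - xs) ≤ Q → L (w - xs) (w - xs) ≤ Q →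
      (G' z - G' w) (z - w) ≤ LB * L (z - w) (z - w)) (z w : H)
    (hz : L (z - xs) (z - xs) ≤ Q) (hw : L (w - xs) (w - xs) ≤ Q) :
    G w ≤ G z + G' z (w - z) + LB / 2 * L (w - z) (w - z) := by
  have := pagd_segment_bound G G' hdiff z (w - z) (LB * L (w - z) (w - z)) (by
      intro t ht ht1
      have hm : L (z + t • (w - z) - xs) (z + t • (w - z) - xs) ≤ Q := by
        have e : z + t • (w - z) - xs = (1 - t) • (z - xs) + t • (w - xs) := by module
        rw [e]
        have := pagd_q_conv L hsymm hnn (z - xs) (w - xs) t ht.le ht1.le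
        nlinarith
      have h1 := hsm (z + t • (w - z)) z hm hz
      rw [add_sub_cancel_left] at h1
      simp only [map_smul, sub_apply, smul_eq_mul, smul_apply] at h1 ⊢
      nlinarith)
  rw [add_sub_cancel] at this
  linarith

/-- a gradient step stays in the ball -/
theorem pagd_step_mem (hsymm : ∀ x y : H, L x y = L y x) (hnn : ∀ x : H, 0 ≤ L x x)
    (G : H → ℝ) (G' : H → H →L[ℝ] ℝ)
    (hdiff : ∀ x : H, HasFDerivAt G (G' x) x) (xs : H) (Q LB μ s : ℝ) (hLB : 0 < LB)
    (hμ : 0 < μ) (hs : s * LB = 1)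
    (hsc : ∀ x y : H, (G' x - G' y) (x - y) ≥ μ * L (x - y) (x - y))
    (hmin : ∀ y : H, G xs ≤ G y)
    (hsm : ∀ z w : H, L (z - xs) (z - xs) ≤ Q → L (w - xs) (w - xs) ≤ Q →
      (G' z - G' w) (z - w) ≤ LB * L (z - w) (z - w)) (y g : H) (hg : L g = G' y)
    (hy : L (y - xs) (y - xs) < Q) :
    L (y - s • g - xs) (y - s • g - xs) ≤ Q := by
  have hspos : 0 < s := by
    by_contra h
    push Not at h
    nlinarith
  by_contra hcon
  push Not at hcon
  have hq : ∀ t : ℝ, L (y - t • g - xs) (y - t • g - xs)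
      = L (y - xs) (y - xs) - 2 * t * L g (y - xs) + t ^ 2 * L g g := by
    intro t
    have e : y - t • g - xs = (y - xs) - t • g := by abel
    rw [e, pagd_q_expand L hsymm]
  have hcont : ContinuousOn (fun t : ℝ => L (y - t • g - xs) (y - t • g - xs))
      (Set.Icc 0 s) := by
    simp_rw [hq]
    fun_prop
  have hmem : Q ∈ Set.Icc ((fun t : ℝ => L (y - t • g - xs) (y - t • g - xs)) 0)
      ((fun t : ℝ => L (y - t • g - xs) (y - t • g - xs)) s) := by
    constructor
    · simpa using hy.le
    · exact hcon.le
  obtain ⟨t, ht, htQ⟩ := intermediate_value_Icc hspos.le hcont hmem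
  simp only at htQ
  have hd := pagd_smooth_upper L hsymm hnn G G' hdiff xs Q LB hsm y (y - t • g) hy.le htQ.le
  have e1 : y - t • g - y = -(t • g) := by abel
  have e2 : L (-(t • g)) (-(t • g)) = t ^ 2 * L g g := by
    simp only [map_neg, map_smul, neg_apply, smul_apply, smul_eq_mul]
    ring
  rw [e1, e2, ← hg] at hd
  have e3 : L g (-(t • g)) = - (t * L g g) := by
    simp only [map_neg, map_smul, smul_eq_mul]
  rw [e3] at hd
  have hl := pagd_strong_lower L G G' hdiff μ hsc y xs
  have e4 : G' y (xs - y) = - L g (y - xs) := by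
    rw [← hg, ← map_neg, neg_sub]
  rw [e4] at hl
  have h5 := mul_nonneg hμ.le (hnn (xs - y))
  have h6 := hmin (y - t • g)
  rw [hq t] at htQ
  have htLB : t * LB ≤ 1 := by
    rw [← hs]
    exact mul_le_mul_of_nonneg_right ht.2 hLB.le
  have h7 : t * L g g / 2 ≤ L g (y - xs) := by
    have := mul_nonneg (mul_nonneg ht.1 (sub_nonneg.2 htLB)) (hnn g)
    nlinarith
  have := mul_le_mul_of_nonneg_left h7 ht.1
  nlinarith

/-- one step of the Lyapunov decay -/
theorem pagd_energy_step (hsymm : ∀ x y : H, L x y = L y x) (hnn : ∀ x : H, 0 ≤ L x x)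
    (G : H → ℝ) (G' : H → H →L[ℝ] ℝ)
    (hdiff : ∀ x : H, HasFDerivAt G (G' x) x) (xs : H) (μ s θ : ℝ)
    (hμ : 0 < μ) (hθ0 : 0 < θ) (hθ1 : θ < 1) (hθ : θ ^ 2 = μ * s)
    (hsc : ∀ x y : H, (G' x - G' y) (x - y) ≥ μ * L (x - y) (x - y))
    (x v y g : H) (hg : L g = G' y)
    (hy : (1 + θ) • y = x + θ • v)
    (hdes : G (y - s • g) ≤ G y - s / 2 * L g g) :
    G (y - s • g) - G xs + μ / 2 * L (x + (1 / θ) • (y - s • g - x) - xs)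
        (x + (1 / θ) • (y - s • g - x) - xs)
      ≤ (1 - θ) * (G x - G xs + μ / 2 * L (v - xs) (v - xs)) := by
  have hx : x = (1 + θ) • y - θ • v := by rw [hy]; abel
  have hv : x + (1 / θ) • (y - s • g - x) - xs
      = ((1 - θ) • (v - xs) + θ • (y - xs)) - (s / θ) • g := by
    rw [hx]
    match_scalars <;> field_simp <;> ring
  rw [hv, pagd_q_expand L hsymm]
  have hc := pagd_q_conv L hsymm hnn (v - xs) (y - xs) θ hθ0.le hθ1.le
  have hl1 := pagd_strong_lower L G G' hdiff μ hsc y xs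
  have hl2 := pagd_strong_lower L G G' hdiff μ hsc y x
  have h5 := mul_nonneg hμ.le (hnn (x - y))
  have e1 : G' y (xs - y) = - L g (y - xs) := by
    rw [← hg, ← map_neg, neg_sub]
  have e2 : L (xs - y) (xs - y) = L (y - xs) (y - xs) := by
    rw [← neg_sub y xs]
    simp only [map_neg, neg_apply, neg_neg]
  have e3 : G' y (x - y) = θ * (L g (y - xs) - L g (v - xs)) := by
    have : x - y = θ • ((y - xs) - (v - xs)) := by rw [hx]; module
    rw [← hg, this, map_smul, map_sub, smul_eq_mul]
  have e4 : L g ((1 - θ) • (v - xs) + θ • (y - xs))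
      = (1 - θ) * L g (v - xs) + θ * L g (y - xs) := by
    simp only [map_add, map_smul, smul_eq_mul]
  rw [e4]
  rw [e1, e2] at hl1
  rw [e3] at hl2
  have c1 : μ * (s / θ) = θ := by
    field_simp
    linarith
  have c2 : μ * (s / θ) ^ 2 = s := by
    have : μ * (s / θ) ^ 2 = (μ * (s / θ)) * (s / θ) := by ring
    rw [this, c1]
    field_simp
  set A := L g (v - xs)
  set B := L g (y - xs)
  set N := L g g
  set V := L (v - xs) (v - xs)
  set Y := L (y - xs) (y - xs)
  set M := L ((1 - θ) • (v - xs) + θ • (y - xs)) ((1 - θ) • (v - xs) + θ • (y - xs))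
  have key : μ / 2 * (M - 2 * (s / θ) * ((1 - θ) * A + θ * B) + (s / θ) ^ 2 * N)
      = μ / 2 * M - θ * ((1 - θ) * A + θ * B) + s / 2 * N := by
    have : μ / 2 * (M - 2 * (s / θ) * ((1 - θ) * A + θ * B) + (s / θ) ^ 2 * N)
      = μ / 2 * M - (μ * (s / θ)) * ((1 - θ) * A + θ * B) + (μ * (s / θ) ^ 2) / 2 * N := by ring
    rw [this, c1, c2]
  rw [key]
  have k1 := mul_le_mul_of_nonneg_left hc (by positivity : (0:ℝ) ≤ μ / 2)
  have k2 := mul_le_mul_of_nonneg_left hl1 hθ0.le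
  have hl2' : G y + θ * (B - A) ≤ G x := by linarith
  have k3 := mul_le_mul_of_nonneg_left hl2' (sub_nonneg.2 hθ1.le)
  nlinarith

end helpers



set_option maxHeartbeats 2000000 in
/-- exponential convergence of the PAGD residuals in the
`𝓛⁻¹`-norm with step size `s = 1/L_B` and `ρ = μ/L_B`: for all `k ≥ 0`,
`‖G'(y_k)‖_{𝓛⁻¹} ≤ 3 L_B √(2E₀/η) (1 − √ρ)^{(k−1)/2}`; moreover
`‖G'(y_k)‖_{𝓛⁻¹} ≤ √(2L_B(G(y_k) − G*)) ≤ L_B ‖y_k − x*‖_𝓛`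
(where `‖f‖_{𝓛⁻¹} = √⟨f, 𝓛⁻¹f⟩`). -/
theorem PAGD_residual_exponential_convergence
    {H : Type*} [NormedAddCommGroup H] [InnerProductSpace ℝ H]
    [CompleteSpace H] [SeparableSpace H]
    (L : H →ₗ[ℝ] (H →L[ℝ] ℝ))
    (C₁ C₂ : ℝ) (hC₁ : 0 < C₁) (hC₂ : 0 < C₂)
    (hsymm : ∀ x y : H, L x y = L y x)
    (hbdd : ∀ x y : H, L x y ≤ C₂ * ‖x‖ * ‖y‖)
    (hcoer : ∀ x : H, C₁ * ‖x‖ ^ 2 ≤ L x x)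
    (Linv : (H →L[ℝ] ℝ) → H)
    (hLinv : ∀ f : H →L[ℝ] ℝ, L (Linv f) = f)
    (hLinv' : ∀ x : H, Linv (L x) = x)
    (G : H → ℝ) (G' : H → H →L[ℝ] ℝ)
    (hdiff : ∀ x : H, HasFDerivAt G (G' x) x)
    (μ : ℝ) (hμ : 0 < μ)
    -- μ-strong convexity
    (hsc : ∀ x y : H, (G' x - G' y) (x - y) ≥ μ * L (x - y) (x - y))
    -- local Lipschitz smoothness
    (hlip : ∀ B : Set H, Convex ℝ B → Bornology.IsBounded B →
      ∃ LB > (0:ℝ), ∀ x ∈ B, ∀ y ∈ B,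
        (G' x - G' y) (x - y) ≤ LB * L (x - y) (x - y))
    -- minimizer and minimum
    (xstar : H) (hmin : ∀ y : H, G xstar ≤ G y)
    (x₀ : H) (r : ℝ) (hr : 1 < r)
    -- the invariant set 𝔅
    (R₁ R₂ R : ℝ)
    (hR₁ : R₁ = Real.sqrt (2 / μ * (G x₀ - G xstar)))
    (hR₂ : R₂ = Real.sqrt (2 * r * (G x₀ - G xstar)))
    (η : ℝ) (hη : η = Real.sqrt μ)
    (hR : R = R₁ + R₂ / η)
    (𝔅 : Set H)
    (h𝔅 : 𝔅 = {z : H | Real.sqrt (L (z - xstar) (z - xstar)) ≤ R})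
    -- L_B : a Lipschitz smoothness constant of G on 𝔅
    (LB : ℝ) (hLB : 0 < LB)
    (hsm : ∀ z ∈ 𝔅, ∀ w ∈ 𝔅, (G' z - G' w) (z - w) ≤ LB * L (z - w) (z - w))
    -- step size restriction
    (s : ℝ) (hsdef : s = 1 / LB)
    (hs' : s ≤ ((r - 1) / (r + 1)) ^ 2 / μ)
    (ρ : ℝ) (hρ : ρ = μ / LB)
    (E₀ : ℝ)
    (hE₀ : E₀ = 1 / η * (G x₀ - G xstar)
                  + η / 2 * L (x₀ - xstar) (x₀ - xstar))
    -- PAGD parameters and iterates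
    (θ lam : ℝ) (hθ : θ = η * Real.sqrt s) (hlam : lam = (1 - θ) / (1 + θ))
    (x y v : ℕ → H)
    (hx0 : x 0 = x₀)
    (hy : ∀ k : ℕ, y k = x k + lam • (x k - x (k - 1)))
    (hx : ∀ k : ℕ, x (k + 1) = y k - s • Linv (G' (y k)))
    (hv0 : v 0 = x 0)
    (hv : ∀ k : ℕ, v (k + 1) = x k + (1 / θ) • (x (k + 1) - x k)) :
    ∀ k : ℕ,
      (Real.sqrt ((G' (y k)) (Linv (G' (y k))))
        ≤ 3 * LB * Real.sqrt (2 * E₀ / η)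
            * (1 - Real.sqrt ρ) ^ (((k : ℝ) - 1) / 2)) ∧
      (Real.sqrt ((G' (y k)) (Linv (G' (y k))))
        ≤ Real.sqrt (2 * LB * (G (y k) - G xstar))) ∧
      (Real.sqrt (2 * LB * (G (y k) - G xstar))
        ≤ LB * Real.sqrt (L (y k - xstar) (y k - xstar))) := by
  have hnn : ∀ z : H, 0 ≤ L z z := fun z =>
    le_trans (mul_nonneg hC₁.le (sq_nonneg _)) (hcoer z)
  have hzero : ∀ z : H, L z z ≤ 0 → z = 0 := by
    intro z hz
    have h1 := hcoer z
    have h2 : ‖z‖ ^ 2 ≤ 0 := by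
      by_contra h
      push Not at h
      have := mul_pos hC₁ h
      linarith
    have h3 : ‖z‖ = 0 := by nlinarith [norm_nonneg z]
    exact norm_eq_zero.1 h3
  have hG'0 : G' xstar = 0 :=
    IsLocalMin.hasFDerivAt_eq_zero (Filter.Eventually.of_forall hmin) (hdiff xstar)
  have hD : 0 ≤ G x₀ - G xstar := sub_nonneg.2 (hmin x₀)
  have hη0 : 0 < η := by rw [hη]; exact Real.sqrt_pos.2 hμ
  have hη2 : η ^ 2 = μ := by rw [hη]; exact Real.sq_sqrt hμ.le
  have hs0 : 0 < s := by rw [hsdef]; positivity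
  have hsLB : s * LB = 1 := by rw [hsdef]; field_simp
  have hθ0 : 0 < θ := by rw [hθ]; exact mul_pos hη0 (Real.sqrt_pos.2 hs0)
  have hθ2 : θ ^ 2 = μ * s := by rw [hθ, mul_pow, hη2, Real.sq_sqrt hs0.le]
  have hθ1 : θ < 1 := by
    have h1 : μ * s ≤ ((r - 1) / (r + 1)) ^ 2 := by
      rw [le_div_iff₀ hμ] at hs'
      linarith
    have h2 : (r - 1) / (r + 1) < 1 := by
      rw [div_lt_one (by linarith)]
      linarith
    have h3 : 0 < (r - 1) / (r + 1) := div_pos (by linarith) (by linarith)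
    nlinarith
  have hθρ : Real.sqrt ρ = θ := by
    have : ρ = θ ^ 2 := by rw [hθ2, hρ, hsdef]; ring
    rw [this, Real.sqrt_sq hθ0.le]
  -- ball
  have hR₁0 : 0 ≤ R₁ := by rw [hR₁]; exact Real.sqrt_nonneg _
  have hR₂0 : 0 ≤ R₂ := by rw [hR₂]; exact Real.sqrt_nonneg _
  have hR0 : 0 ≤ R := by rw [hR]; positivity
  have hRsq : (2 + 2 * r) * (G x₀ - G xstar) / μ ≤ R ^ 2 := by
    have h1 : R₁ ^ 2 = 2 / μ * (G x₀ - G xstar) := by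
      rw [hR₁]; exact Real.sq_sqrt (by positivity)
    have h2 : (R₂ / η) ^ 2 = 2 * r * (G x₀ - G xstar) / μ := by
      rw [div_pow, hη2, hR₂, Real.sq_sqrt (by positivity)]
    have h3 : 0 ≤ R₁ * (R₂ / η) := by positivity
    have h4 : (2 + 2 * r) * (G x₀ - G xstar) / μ
        = 2 / μ * (G x₀ - G xstar) + 2 * r * (G x₀ - G xstar) / μ := by ring
    rw [h4, ← h1, ← h2, hR]
    nlinarith
  have hsm' : ∀ z w : H, L (z - xstar) (z - xstar) ≤ R ^ 2 →
      L (w - xstar) (w - xstar) ≤ R ^ 2 →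
      (G' z - G' w) (z - w) ≤ LB * L (z - w) (z - w) := by
    intro z w hz hw
    apply hsm
    · rw [h𝔅]; exact (Real.sqrt_le_left hR0).2 hz
    · rw [h𝔅]; exact (Real.sqrt_le_left hR0).2 hw
  have hlow : ∀ z : H, μ / 2 * L (z - xstar) (z - xstar) ≤ G z - G xstar := by
    intro z
    have := pagd_strong_lower L G G' hdiff μ hsc xstar z
    rw [hG'0] at this
    simp only [zero_apply] at this
    linarith
  -- y as a combination
  have hycomb : ∀ k, (1 + θ) • y k = x k + θ • v k := by
    intro k
    rw [hy k, hlam]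
    cases k with
    | zero =>
      rw [hv0]
      simp only [Nat.zero_sub, sub_self, smul_zero, add_zero]
      module
    | succ n =>
      rw [hv n]
      simp only [Nat.add_sub_cancel]
      have : 1 + θ ≠ 0 := by positivity
      match_scalars <;> field_simp <;> ring
  have hW0 : G x₀ - G xstar + μ / 2 * L (x₀ - xstar) (x₀ - xstar) = η * E₀ := by
    rw [hE₀, ← hη2]
    field_simp
  have hW0le : η * E₀ ≤ 2 * (G x₀ - G xstar) := by
    rw [← hW0]
    linarith [hlow x₀]
  have hW0nn : 0 ≤ η * E₀ := by
    rw [← hW0]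
    have := mul_nonneg hμ.le (hnn (x₀ - xstar))
    linarith
  -- bound on y from the energy
  have hyb : ∀ k, ∀ W : ℝ, G (x k) - G xstar + μ / 2 * L (v k - xstar) (v k - xstar) ≤ W →
      μ / 2 * L (y k - xstar) (y k - xstar) ≤ W := by
    intro k W hW
    have h1 := hlow (x k)
    have h2 := hmin (x k)
    have h3 := mul_nonneg hμ.le (hnn (v k - xstar))
    have hpos : 0 < 1 + θ := by positivity
    set t := θ / (1 + θ) with ht
    have ht0 : 0 ≤ t := by positivity
    have ht1 : t ≤ 1 := by rw [ht, div_le_one hpos]; linarith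
    have e : y k - xstar = (1 - t) • (x k - xstar) + t • (v k - xstar) := by
      have e1 : y k = (1 + θ)⁻¹ • (x k + θ • v k) := by
        rw [← hycomb k, smul_smul, inv_mul_cancel₀ hpos.ne', one_smul]
      rw [e1, ht]
      match_scalars <;> field_simp <;> ring
    have h4 := pagd_q_conv L hsymm hnn (x k - xstar) (v k - xstar) t ht0 ht1
    rw [← e] at h4
    have h5 := mul_le_mul_of_nonneg_left h4 (by positivity : (0:ℝ) ≤ μ / 2)
    have h6 : μ / 2 * L (x k - xstar) (x k - xstar) ≤ W := by linarith
    have h7 : μ / 2 * L (v k - xstar) (v k - xstar) ≤ W := by linarith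
    have h8 := mul_le_mul_of_nonneg_left h6 (sub_nonneg.2 ht1)
    have h9 := mul_le_mul_of_nonneg_left h7 ht0
    nlinarith
  -- membership and descent
  have hmem : ∀ k, G (x k) - G xstar + μ / 2 * L (v k - xstar) (v k - xstar) ≤ η * E₀ →
      L (y k - xstar) (y k - xstar) ≤ R ^ 2 ∧
      L (y k - s • Linv (G' (y k)) - xstar) (y k - s • Linv (G' (y k)) - xstar) ≤ R ^ 2 := by
    intro k hk
    have h1 := hyb k _ hk
    rcases hD.eq_or_lt with hD0 | hDpos
    · have h2 : L (y k - xstar) (y k - xstar) ≤ 0 := by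
        by_contra h
        push Not at h
        have := mul_pos hμ h
        linarith
      have h3 : y k = xstar := sub_eq_zero.1 (hzero _ h2)
      have h4 : Linv (0 : H →L[ℝ] ℝ) = 0 := by
        have := hLinv' 0
        rwa [map_zero] at this
      rw [h3, hG'0, h4]
      simp only [smul_zero, sub_zero, sub_self, map_zero, zero_apply]
      exact ⟨sq_nonneg R, sq_nonneg R⟩
    · have h2 : L (y k - xstar) (y k - xstar) < R ^ 2 := by
        refine lt_of_lt_of_le ?_ hRsq
        rw [lt_div_iff₀ hμ]
        nlinarith
      exact ⟨h2.le, pagd_step_mem L hsymm hnn G G' hdiff xstar (R ^ 2) LB μ s hLB hμ hsLB hsc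
        hmin hsm' (y k) _ (hLinv _) h2⟩
  have hdesc : ∀ k, G (x k) - G xstar + μ / 2 * L (v k - xstar) (v k - xstar) ≤ η * E₀ →
      G (y k - s • Linv (G' (y k))) ≤ G (y k)
        - s / 2 * L (Linv (G' (y k))) (Linv (G' (y k))) := by
    intro k hk
    obtain ⟨h1, h2⟩ := hmem k hk
    have hd := pagd_smooth_upper L hsymm hnn G G' hdiff xstar (R ^ 2) LB hsm' _ _ h1 h2
    set g := Linv (G' (y k)) with hgdef
    have hg : L g = G' (y k) := hLinv _
    have e1 : y k - s • g - y k = -(s • g) := by abel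
    have e2 : L (-(s • g)) (-(s • g)) = s ^ 2 * L g g := by
      simp only [map_neg, map_smul, neg_apply, smul_apply, smul_eq_mul]
      ring
    have e3 : L g (-(s • g)) = - (s * L g g) := by
      simp only [map_neg, map_smul, smul_eq_mul]
    rw [e1, e2, ← hg, e3] at hd
    have e4 : LB / 2 * (s ^ 2 * L g g) = s / 2 * L g g := by
      have : LB / 2 * (s ^ 2 * L g g) = (s * LB) * s / 2 * L g g := by ring
      rw [this, hsLB, one_mul]
    linarith
  have hEn : ∀ k, G (x k) - G xstar + μ / 2 * L (v k - xstar) (v k - xstar)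
      ≤ (1 - θ) ^ k * (η * E₀) := by
    intro k
    induction k with
    | zero => rw [hv0, hx0, hW0]; simp
    | succ n ih =>
      have hpow : (1 - θ) ^ n ≤ 1 := pow_le_one₀ (by linarith) (by linarith)
      have hle := ih.trans (mul_le_of_le_one_left hW0nn hpow)
      have hst := pagd_energy_step L hsymm hnn G G' hdiff xstar μ s θ hμ hθ0 hθ1 hθ2 hsc
        (x n) (v n) (y n) _ (hLinv _) (hycomb n) (hdesc n hle)
      rw [← hx n, ← hv n] at hst
      refine hst.trans ?_
      rw [pow_succ']
      have := mul_le_mul_of_nonneg_left ih (sub_nonneg.2 hθ1.le)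
      linarith
  intro k
  have hpow : (1 - θ) ^ k ≤ 1 := pow_le_one₀ (by linarith) (by linarith)
  have hle := (hEn k).trans (mul_le_of_le_one_left hW0nn hpow)
  obtain ⟨hm1, hm2⟩ := hmem k hle
  have hgg : L (Linv (G' (y k))) (Linv (G' (y k))) = G' (y k) (Linv (G' (y k))) := by
    rw [hLinv]
  have hB : Real.sqrt ((G' (y k)) (Linv (G' (y k))))
        ≤ Real.sqrt (2 * LB * (G (y k) - G xstar)) := by
    apply Real.sqrt_le_sqrt
    rw [← hgg]
    have h1 := hdesc k hle
    have h2 := hmin (y k - s • Linv (G' (y k)))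
    have h3 : s / 2 * L (Linv (G' (y k))) (Linv (G' (y k))) ≤ G (y k) - G xstar := by linarith
    have h4 := mul_le_mul_of_nonneg_left h3 (by positivity : 0 ≤ 2 * LB)
    have h5 : 2 * LB * (s / 2 * L (Linv (G' (y k))) (Linv (G' (y k))))
        = (s * LB) * L (Linv (G' (y k))) (Linv (G' (y k))) := by ring
    rw [h5, hsLB, one_mul] at h4
    exact h4
  have hC : Real.sqrt (2 * LB * (G (y k) - G xstar))
        ≤ LB * Real.sqrt (L (y k - xstar) (y k - xstar)) := by
    have h1 : L (xstar - xstar) (xstar - xstar) ≤ R ^ 2 := by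
      simp only [sub_self, map_zero]
      exact sq_nonneg R
    have h2 := pagd_smooth_upper L hsymm hnn G G' hdiff xstar (R ^ 2) LB hsm' _ _ h1 hm1
    rw [hG'0] at h2
    simp only [zero_apply] at h2
    have h3 : LB * Real.sqrt (L (y k - xstar) (y k - xstar))
        = Real.sqrt (LB ^ 2 * L (y k - xstar) (y k - xstar)) := by
      rw [Real.sqrt_mul (sq_nonneg LB), Real.sqrt_sq hLB.le]
    rw [h3]
    apply Real.sqrt_le_sqrt
    nlinarith
  refine ⟨(hB.trans hC).trans ?_, hB, hC⟩
  rw [hθρ]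
  have h1θ : 0 < 1 - θ := by linarith
  have hyk : L (y k - xstar) (y k - xstar) ≤ (2 * E₀ / η) * (1 - θ) ^ k := by
    have := hyb k _ (hEn k)
    have e : (2 * E₀ / η) * (1 - θ) ^ k = 2 / μ * ((1 - θ) ^ k * (η * E₀)) := by
      rw [← hη2]; field_simp
    rw [e]
    have h2 := mul_le_mul_of_nonneg_left this (by positivity : 0 ≤ 2 / μ)
    have e2 : 2 / μ * (μ / 2 * L (y k - xstar) (y k - xstar))
        = L (y k - xstar) (y k - xstar) := by field_simp
    rwa [e2] at h2
  have hE₀nn : 0 ≤ E₀ := by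
    by_contra h
    push Not at h
    have := mul_neg_of_pos_of_neg hη0 h
    linarith
  have hsq : Real.sqrt (L (y k - xstar) (y k - xstar))
      ≤ Real.sqrt (2 * E₀ / η) * (1 - θ) ^ (((k : ℝ) - 1) / 2) := by
    refine (Real.sqrt_le_sqrt hyk).trans ?_
    rw [Real.sqrt_mul (by positivity)]
    apply mul_le_mul_of_nonneg_left _ (Real.sqrt_nonneg _)
    rw [Real.sqrt_eq_rpow, ← Real.rpow_natCast, ← Real.rpow_mul h1θ.le]
    apply Real.rpow_le_rpow_of_exponent_ge h1θ (by linarith)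
    linarith
  have h2 := mul_le_mul_of_nonneg_left hsq hLB.le
  have h3 : 0 ≤ LB * (Real.sqrt (2 * E₀ / η) * (1 - θ) ^ (((k : ℝ) - 1) / 2)) := by
    have := Real.rpow_pos_of_pos h1θ (((k : ℝ) - 1) / 2)
    positivity
  nlinarith
end
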